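/- arXiv:1702.04745 — 2 statements merged into one kernel-verified Lean document; each statement's English description precedes it below -/
import Mathlib

section
/- For n ≥ 1, let X_n be the random variable 'total height' (sum over all vertices of the graph distance to the root) on the set of rooted labeled trees on n vertices, equipped with the uniform distribution. Let μ(n) = E[X_n], m_i(n) = E[(X_n − μ(n))^i], and α_i(n) = m_i(n)/m_2(n)^{i/2}. Then lim_{n→∞} α_5(n) = (36π² + (75/2)π − 105845/224)·√3·√(π/(10 − 3π)) / (10 − 3π)² ≈ 7.2563753582799571…. -/
open Classical in
/-- The set of rooted labeled trees on `n` vertices: pairs `(T, r)` where `T` is a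
tree (connected acyclic simple graph) on the vertex set `{1,…,n}` (modeled as `Fin n`)
and `r` is a distinguished root vertex. -/
noncomputable def RootedLabeledTrees (n : ℕ) : Finset (SimpleGraph (Fin n) × Fin n) :=
  Finset.univ.filter (fun p => p.1.IsTree)

/-- The total height of a rooted labeled tree `(T, r)`: the sum over all vertices `v`
of the graph distance in `T` from `v` to the root `r`. -/
noncomputable def rlTotalHeight (n : ℕ) (p : SimpleGraph (Fin n) × Fin n) : ℕ :=
  ∑ v : Fin n, p.1.dist v p.2

/-- The mean of the total height on rooted labeled trees on `n` vertices, under the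
uniform distribution. -/
noncomputable def rlMu (n : ℕ) : ℝ :=
  (∑ p ∈ RootedLabeledTrees n, (rlTotalHeight n p : ℝ)) / ((RootedLabeledTrees n).card : ℝ)

/-- The `i`-th central moment of the total height on rooted labeled trees on `n`
vertices, under the uniform distribution. -/
noncomputable def rlCentralMoment (i n : ℕ) : ℝ :=
  (∑ p ∈ RootedLabeledTrees n, ((rlTotalHeight n p : ℝ) - rlMu n) ^ i) /
    ((RootedLabeledTrees n).card : ℝ)

/-- The `i`-th scaled moment `α_i(n) = m_i(n) / m_2(n)^(i/2)` of the total height on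
rooted labeled trees on `n` vertices. -/
noncomputable def rlAlpha (i n : ℕ) : ℝ :=
  rlCentralMoment i n / (rlCentralMoment 2 n) ^ ((i : ℝ) / 2)

section
namespace TH
open SimpleGraph

lemma reach_map {V W : Type*} {G : SimpleGraph V} {H : SimpleGraph W} (f : V → W)
    (h : ∀ x y, G.Adj x y → H.Reachable (f x) (f y)) {x y : V} (hr : G.Reachable x y) :
    H.Reachable (f x) (f y) := by
  obtain ⟨p⟩ := hr
  induction p with
  | nil => exact Reachable.refl _
  | cons ha _ ih => exact (h _ _ ha).trans ih

lemma lip_le_dist {V : Type*} {G : SimpleGraph V} (hG : G.Connected) (f : V → ℕ) (r : V)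
    (h0 : f r = 0) (h : ∀ x y, G.Adj x y → f x ≤ f y + 1) (v : V) : f v ≤ G.dist v r := by
  obtain ⟨p, hp⟩ := hG.exists_walk_length_eq_dist v r
  rw [← hp]
  clear hp
  induction p with
  | nil => simp [h0]
  | cons ha _ ih =>
    have := h _ _ ha
    have := ih h0
    simp only [Walk.length_cons]
    omega

lemma dist_hom_le {V W : Type*} {G : SimpleGraph V} {H : SimpleGraph W} (hG : G.Connected)
    (f : G →g H) (x y : V) : H.dist (f x) (f y) ≤ G.dist x y := by
  obtain ⟨p, hp⟩ := hG.exists_walk_length_eq_dist x y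
  rw [← hp, ← Walk.length_map f p]
  exact dist_le _

variable {V : Type*}

/-- glue two graphs along an edge -/
def glue (A : Finset V) (G₁ : SimpleGraph {x // x ∈ A}) (G₂ : SimpleGraph {x // x ∉ A})
    (r : {x // x ∈ A}) (c : {x // x ∉ A}) : SimpleGraph V where
  Adj x y := (∃ hx hy, G₁.Adj ⟨x, hx⟩ ⟨y, hy⟩) ∨ (∃ hx hy, G₂.Adj ⟨x, hx⟩ ⟨y, hy⟩) ∨
    (x = r ∧ y = c) ∨ (x = c ∧ y = r)
  symm := ⟨by
    rintro x y (⟨hx, hy, h⟩ | ⟨hx, hy, h⟩ | ⟨h, h'⟩ | ⟨h, h'⟩)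
    · exact Or.inl ⟨hy, hx, h.symm⟩
    · exact Or.inr (Or.inl ⟨hy, hx, h.symm⟩)
    · exact Or.inr (Or.inr (Or.inr ⟨h', h⟩))
    · exact Or.inr (Or.inr (Or.inl ⟨h', h⟩))⟩
  loopless := ⟨by
    rintro x (⟨hx, hy, h⟩ | ⟨hx, hy, h⟩ | ⟨h, h'⟩ | ⟨h, h'⟩)
    · exact G₁.loopless.irrefl _ h
    · exact G₂.loopless.irrefl _ h
    · exact c.2 (h' ▸ h ▸ r.2)
    · exact c.2 (h ▸ h' ▸ r.2)⟩

variable {A : Finset V} {G₁ : SimpleGraph {x // x ∈ A}} {G₂ : SimpleGraph {x // x ∉ A}}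
    {r : {x // x ∈ A}} {c : {x // x ∉ A}}

def glueL : G₁ →g glue A G₁ G₂ r c where
  toFun x := x
  map_rel' := fun {a b} h => Or.inl ⟨a.2, b.2, h⟩

def glueR : G₂ →g glue A G₁ G₂ r c where
  toFun x := x
  map_rel' := fun {a b} h => Or.inr (Or.inl ⟨a.2, b.2, h⟩)

lemma glue_adj_rc : (glue A G₁ G₂ r c).Adj r c := Or.inr (Or.inr (Or.inl ⟨rfl, rfl⟩))

lemma glue_connected (h₁ : G₁.Connected) (h₂ : G₂.Connected) : (glue A G₁ G₂ r c).Connected := by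
  have key : ∀ v, (glue A G₁ G₂ r c).Reachable v r := by
    intro v
    by_cases hv : v ∈ A
    · exact (h₁.preconnected ⟨v, hv⟩ r).map glueL
    · exact ((h₂.preconnected ⟨v, hv⟩ c).map glueR).trans glue_adj_rc.symm.reachable
  have : Nonempty V := ⟨r⟩
  exact ⟨fun u v => (key u).trans (key v).symm⟩

open Classical in
lemma glue_acyclic (h₁ : G₁.IsAcyclic) (h₂ : G₂.IsAcyclic) : (glue A G₁ G₂ r c).IsAcyclic := by
  rw [isAcyclic_iff_forall_adj_isBridge] at *
  intro u v huv
  rw [isBridge_iff]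
  rcases huv with (⟨hx, hy, h⟩ | ⟨hx, hy, h⟩ | ⟨h, h'⟩ | ⟨h, h'⟩)
  · have hb := h₁ h
    rw [isBridge_iff] at hb
    intro hre
    apply hb
    have := reach_map (H := G₁.deleteEdges {s(⟨u, hx⟩, ⟨v, hy⟩)})
      (fun x => if hx : x ∈ A then (⟨x, hx⟩ : {x // x ∈ A}) else r) ?_ hre
    · simpa [hx, hy] using this
    · intro x y hxy
      rw [deleteEdges_adj] at hxy
      obtain ⟨hxy, hne⟩ := hxy
      rcases hxy with (⟨hx', hy', h⟩ | ⟨hx', hy', h⟩ | ⟨rfl, rfl⟩ | ⟨rfl, rfl⟩)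
      · simp only [hx', hy', dite_true]
        apply Adj.reachable
        rw [deleteEdges_adj]
        refine ⟨h, ?_⟩
        simpa using hne
      · simp [hx', hy']
      · simp [c.2]
      · simp [c.2]
  · have hb := h₂ h
    rw [isBridge_iff] at hb
    intro hre
    apply hb
    have := reach_map (H := G₂.deleteEdges {s(⟨u, hx⟩, ⟨v, hy⟩)})
      (fun x => if hx : x ∉ A then (⟨x, hx⟩ : {x // x ∉ A}) else c) ?_ hre
    · simpa [hx, hy] using this
    · intro x y hxy
      rw [deleteEdges_adj] at hxy
      obtain ⟨hxy, hne⟩ := hxy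
      rcases hxy with (⟨hx', hy', h⟩ | ⟨hx', hy', h⟩ | ⟨rfl, rfl⟩ | ⟨rfl, rfl⟩)
      · simp [hx', hy']
      · simp only [hx', hy', dite_true, not_false_eq_true]
        apply Adj.reachable
        rw [deleteEdges_adj]
        refine ⟨h, ?_⟩
        simpa using hne
      · simp [c.2]
      · simp [c.2]
  all_goals
    intro hre
    have := reach_map (H := (⊥ : SimpleGraph Prop)) (fun x => x ∈ A) ?_ hre
    · rw [reachable_bot] at this
      subst h h'
      simp [c.2] at this
    · intro x y hxy
      rw [deleteEdges_adj] at hxy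
      obtain ⟨hxy, hne⟩ := hxy
      subst h h'
      rcases hxy with (⟨hx', hy', h⟩ | ⟨hx', hy', h⟩ | ⟨rfl, rfl⟩ | ⟨rfl, rfl⟩)
      · simp [hx', hy']
      · simp [hx', hy']
      · simp at hne
      · simp at hne

lemma glue_tree (h₁ : G₁.IsTree) (h₂ : G₂.IsTree) : (glue A G₁ G₂ r c).IsTree :=
  ⟨glue_connected h₁.1 h₂.1, glue_acyclic h₁.2 h₂.2⟩

open Classical in
lemma glue_dist_r (h₁ : G₁.IsTree) (h₂ : G₂.IsTree) (v : V) : (glue A G₁ G₂ r c).dist v r =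
    if h : v ∈ A then G₁.dist ⟨v, h⟩ r else G₂.dist ⟨v, h⟩ c + 1 := by
  have hc := glue_connected (r := r) (c := c) h₁.1 h₂.1
  apply le_antisymm
  · split_ifs with h
    · exact dist_hom_le h₁.1 glueL ⟨v, h⟩ r
    · refine (hc.dist_triangle (v := (c : V))).trans ?_
      have := dist_hom_le h₂.1 (glueR (A := A) (G₁ := G₁) (r := r) (c := c)) ⟨v, h⟩ c
      rw [dist_eq_one_iff_adj.2 glue_adj_rc.symm]
      exact Nat.add_le_add_right this 1
  · apply lip_le_dist hc (fun v => if h : v ∈ A then G₁.dist ⟨v, h⟩ r else G₂.dist ⟨v, h⟩ c + 1)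
    · simp
    · rintro x y (⟨hx', hy', h⟩ | ⟨hx', hy', h⟩ | ⟨rfl, rfl⟩ | ⟨rfl, rfl⟩)
      · have := h₁.1.dist_triangle (u := ⟨x, hx'⟩) (v := ⟨y, hy'⟩) (w := r)
        rw [dist_eq_one_iff_adj.2 h] at this
        simp only [hx', hy', dite_true]; omega
      · have := h₂.1.dist_triangle (u := ⟨x, hx'⟩) (v := ⟨y, hy'⟩) (w := c)
        rw [dist_eq_one_iff_adj.2 h] at this
        simp only [hx', hy', dite_false]; omega
      · simp
      · simp [c.2]

open Classical in
lemma glue_dist_c (h₁ : G₁.IsTree) (h₂ : G₂.IsTree) (v : V) : (glue A G₁ G₂ r c).dist v c =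
    if h : v ∈ A then G₁.dist ⟨v, h⟩ r + 1 else G₂.dist ⟨v, h⟩ c := by
  have hc := glue_connected (r := r) (c := c) h₁.1 h₂.1
  apply le_antisymm
  · split_ifs with h
    · refine (hc.dist_triangle (v := (r : V))).trans ?_
      have := dist_hom_le h₁.1 (glueL (A := A) (G₂ := G₂) (r := r) (c := c)) ⟨v, h⟩ r
      rw [dist_eq_one_iff_adj.2 glue_adj_rc]
      exact Nat.add_le_add_right this 1
    · exact dist_hom_le h₂.1 glueR ⟨v, h⟩ c
  · apply lip_le_dist hc (fun v => if h : v ∈ A then G₁.dist ⟨v, h⟩ r + 1 else G₂.dist ⟨v, h⟩ c)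
    · simp [c.2]
    · rintro x y (⟨hx', hy', h⟩ | ⟨hx', hy', h⟩ | ⟨rfl, rfl⟩ | ⟨rfl, rfl⟩)
      · have := h₁.1.dist_triangle (u := ⟨x, hx'⟩) (v := ⟨y, hy'⟩) (w := r)
        rw [dist_eq_one_iff_adj.2 h] at this
        simp only [hx', hy', dite_true]; omega
      · have := h₂.1.dist_triangle (u := ⟨x, hx'⟩) (v := ⟨y, hy'⟩) (w := c)
        rw [dist_eq_one_iff_adj.2 h] at this
        simp only [hx', hy', dite_false]; omega
      · simp [c.2]
      · simp [c.2]

open Classical in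
/-- side of `r` -/
noncomputable def side [Fintype V] (G : SimpleGraph V) (r c : V) : Finset V :=
  Finset.univ.filter fun v => G.dist v r < G.dist v c

lemma glue_side [Fintype V] (h₁ : G₁.IsTree) (h₂ : G₂.IsTree) :
    side (glue A G₁ G₂ r c) r c = A := by
  classical
  ext v
  simp only [side, Finset.mem_filter, Finset.mem_univ, true_and, glue_dist_r h₁ h₂,
    glue_dist_c h₁ h₂]
  by_cases h : v ∈ A <;> simp [h]

lemma glue_comapL : (glue A G₁ G₂ r c).comap (fun x : {x // x ∈ A} => (x : V)) = G₁ := by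
  ext x y
  rw [comap_adj]
  constructor
  · rintro (⟨hx', hy', h⟩ | ⟨hx', hy', h⟩ | ⟨h, h'⟩ | ⟨h, h'⟩)
    · exact h
    · exact absurd x.2 hx'
    · exact absurd (h' ▸ y.2) c.2
    · exact absurd (h ▸ x.2) c.2
  · intro h
    exact Or.inl ⟨x.2, y.2, h⟩

lemma glue_comapR : (glue A G₁ G₂ r c).comap (fun x : {x // x ∉ A} => (x : V)) = G₂ := by
  ext x y
  rw [comap_adj]
  constructor
  · rintro (⟨hx', hy', h⟩ | ⟨hx', hy', h⟩ | ⟨h, h'⟩ | ⟨h, h'⟩)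
    · exact absurd hx' x.2
    · exact h
    · exact absurd (h ▸ r.2) x.2
    · exact absurd (h' ▸ r.2) y.2
  · intro h
    exact Or.inr (Or.inl ⟨x.2, y.2, h⟩)

/-- next vertex toward the root -/
lemma exists_closer {G : SimpleGraph V} (hG : G.Connected) {v r : V} (h : v ≠ r) :
    ∃ w, G.Adj v w ∧ G.dist v r = G.dist w r + 1 := by
  obtain ⟨p, hp⟩ := hG.exists_walk_length_eq_dist v r
  cases p with
  | nil => exact absurd rfl h
  | @cons _ w _ ha q =>
    refine ⟨w, ha, ?_⟩
    rw [Walk.length_cons] at hp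
    have h1 := dist_le q
    have h2 := hG.dist_triangle (u := v) (v := w) (w := r)
    rw [dist_eq_one_iff_adj.2 ha] at h2
    omega

lemma comap_tree {G : SimpleGraph V} (hG : G.IsTree) (P : V → Prop) (r : V) (hr : P r)
    (h : ∀ v, P v → v ≠ r → ∀ w, G.Adj v w → G.dist v r = G.dist w r + 1 → P w) :
    (G.comap (fun x : {x // P x} => (x : V))).IsTree := by
  have key : ∀ n, ∀ v (hv : P v), G.dist v r = n →
      (G.comap (fun x : {x // P x} => (x : V))).Reachable ⟨v, hv⟩ ⟨r, hr⟩ := by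
    intro n
    induction n with
    | zero =>
      intro v hv h0
      rw [hG.1.dist_eq_zero_iff] at h0
      subst h0
      exact Reachable.refl _
    | succ n ih =>
      intro v hv hn
      have hne : v ≠ r := by rintro rfl; simp at hn
      obtain ⟨w, hw, hd⟩ := exists_closer hG.1 hne
      have hPw := h v hv hne w hw hd
      refine Reachable.trans (Adj.reachable ?_) (ih w hPw (by omega))
      exact hw
  refine ⟨?_, ?_⟩
  · have : Nonempty {x // P x} := ⟨⟨r, hr⟩⟩
    exact ⟨fun u v => (key _ u.1 u.2 rfl).trans (key _ v.1 v.2 rfl).symm⟩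
  · exact hG.2.of_comap ⟨_, Subtype.val_injective⟩

lemma split_left [Fintype V] {G : SimpleGraph V} (hG : G.IsTree) {r c : V} (ha : G.Adj r c) :
    (G.comap (fun x : {x // x ∈ side G r c} => (x : V))).IsTree := by
  apply comap_tree hG _ r
  · simp [side, dist_eq_one_iff_adj.2 ha]
  · intro v hv hne w hw hd
    simp only [side, Finset.mem_filter, Finset.mem_univ, true_and] at *
    have h2 := hG.1.dist_triangle (u := v) (v := w) (w := c)
    rw [dist_eq_one_iff_adj.2 hw] at h2
    omega

lemma split_right [Fintype V] {G : SimpleGraph V} (hG : G.IsTree) {r c : V} (ha : G.Adj r c) :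
    (G.comap (fun x : {x // x ∉ side G r c} => (x : V))).IsTree := by
  apply comap_tree hG _ c
  · simp [side]
  · intro v hv hne w hw hd
    simp only [side, Finset.mem_filter, Finset.mem_univ, true_and] at *
    have h2 := hG.1.dist_triangle (u := v) (v := w) (w := r)
    rw [dist_eq_one_iff_adj.2 hw] at h2
    have := hG.dist_ne_of_adj v ha
    omega

lemma glue_split [Fintype V] {G : SimpleGraph V} (hG : G.IsTree) {r c : V} (ha : G.Adj r c)
    (hr : r ∈ side G r c) (hc : c ∉ side G r c) :
    glue (side G r c) (G.comap (fun x : {x // x ∈ side G r c} => (x : V)))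
      (G.comap (fun x : {x // x ∉ side G r c} => (x : V))) ⟨r, hr⟩ ⟨c, hc⟩ = G := by
  have hmin := isTree_iff_minimal_connected.1 hG
  have hle : glue (side G r c) (G.comap (fun x : {x // x ∈ side G r c} => (x : V)))
      (G.comap (fun x : {x // x ∉ side G r c} => (x : V))) ⟨r, hr⟩ ⟨c, hc⟩ ≤ G := by
    rintro x y (⟨hx', hy', h⟩ | ⟨hx', hy', h⟩ | ⟨h, h'⟩ | ⟨h, h'⟩)
    · exact h
    · exact h
    · simpa [h, h'] using ha
    · simpa [h, h'] using ha.symm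
  exact (hmin.eq_of_le (glue_connected (split_left hG ha).1 (split_right hG ha).1) hle).symm.symm

lemma unique_child {G : SimpleGraph V} (hG : G.IsTree) {r v : V} (h : v ≠ r) :
    ∃! c, G.Adj r c ∧ G.dist v c < G.dist v r := by
  have uniq : ∀ c, G.Adj r c → G.dist v c < G.dist v r → 
      ∃ p : G.Path v r, (p : G.Walk v r).penultimate = c := by
    intro c hc hd
    obtain ⟨p, hp⟩ := hG.1.exists_walk_length_eq_dist v c
    have h2 := hG.1.dist_triangle (u := v) (v := c) (w := r)
    rw [dist_eq_one_iff_adj.2 hc.symm] at h2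
    refine ⟨⟨p.concat hc.symm, ?_⟩, ?_⟩
    · apply Walk.isPath_of_length_eq_dist
      rw [Walk.length_concat]
      omega
    · simp
  obtain ⟨w, hw, hd⟩ := exists_closer hG.1 h.symm
  refine ⟨w, ⟨hw, ?_⟩, ?_⟩
  · rw [dist_comm, dist_comm (u := v)]; omega
  · rintro c ⟨hc, hcd⟩
    obtain ⟨p, rfl⟩ := uniq c hc hcd
    obtain ⟨q, rfl⟩ := uniq w hw (by rw [dist_comm, dist_comm (u := v)]; omega)
    rw [(hG.2.subsingleton_path v r).elim p q]

end TH

end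

section
namespace TH
open SimpleGraph Finset

/-- total height on any finite type -/
noncomputable def ht {V : Type*} [Fintype V] (p : SimpleGraph V × V) : ℕ := ∑ v, p.1.dist v p.2

open Classical in
/-- rooted trees on a finite type -/
noncomputable def rt (V : Type*) [Fintype V] : Finset (SimpleGraph V × V) :=
  Finset.univ.filter (fun p => p.1.IsTree)

open Classical in
lemma mem_rt {V : Type*} [Fintype V] (p : SimpleGraph V × V) : p ∈ rt V ↔ p.1.IsTree := by
  simp [rt]

/-- moment sums -/
noncomputable def S (k n : ℕ) : ℝ := ∑ p ∈ rt (Fin n), (ht p : ℝ) ^ k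

lemma dist_iso {V W : Type*} {G : SimpleGraph V} {H : SimpleGraph W} (e : G ≃g H)
    (hG : G.Connected) (x y : V) : H.dist (e x) (e y) = G.dist x y := by
  apply le_antisymm
  · exact dist_hom_le hG e.toHom x y
  · have := dist_hom_le (e.connected_iff.1 hG) e.symm.toHom (e x) (e y)
    simpa using this

lemma sum_rt_equiv {V W : Type*} [Fintype V] [Fintype W] (e : V ≃ W) (φ : ℕ → ℝ) :
    ∑ p ∈ rt V, φ (ht p) = ∑ p ∈ rt W, φ (ht p) := by
  classical
  refine Finset.sum_nbij' (fun p => (p.1.map e.toEmbedding, e p.2))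
    (fun p => (p.1.map e.symm.toEmbedding, e.symm p.2)) ?_ ?_ ?_ ?_ ?_
  · intro p hp
    rw [mem_rt] at *
    exact (Iso.isTree_iff (Iso.map e p.1)).1 hp
  · intro p hp
    rw [mem_rt] at *
    exact (Iso.isTree_iff (Iso.map e.symm p.1)).1 hp
  · intro p hp
    ext <;> simp
  · intro p hp
    ext <;> simp
  · intro p hp
    rw [mem_rt] at hp
    congr 1
    unfold ht
    rw [← e.sum_comp]
    refine Finset.sum_congr rfl fun v _ => ?_
    exact (dist_iso (Iso.map e p.1) hp.1 v p.2).symm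

lemma sum_rt_card {V : Type*} [Fintype V] (n : ℕ) (h : Fintype.card V = n) (φ : ℕ → ℝ) :
    ∑ p ∈ rt V, φ (ht p) = ∑ p ∈ rt (Fin n), φ (ht p) :=
  sum_rt_equiv (Fintype.equivFinOfCardEq h) φ

variable {V : Type*} [Fintype V] 

open Classical in
lemma sum_sub_compl (A : Finset V) (f : V → ℕ) :
    ∑ v, f v = ∑ v : {x // x ∈ A}, f v + ∑ v : {x // x ∉ A}, f v := by
  convert (Fintype.sum_subtype_add_sum_subtype (fun x => x ∈ A) f).symm

open Classical in
lemma ht_glue {A : Finset V} {G₁ : SimpleGraph {x // x ∈ A}} {G₂ : SimpleGraph {x // x ∉ A}}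
    {r : {x // x ∈ A}} {c : {x // x ∉ A}} (h₁ : G₁.IsTree) (h₂ : G₂.IsTree) :
    ht (glue A G₁ G₂ r c, (r : V)) = ht (G₁, r) + (ht (G₂, c) + Fintype.card {x // x ∉ A}) := by
  unfold ht
  rw [sum_sub_compl A]
  congr 1
  · refine Finset.sum_congr rfl fun v _ => ?_
    simp [glue_dist_r h₁ h₂]
  · rw [← Finset.card_univ, Finset.card_eq_sum_ones, ← Finset.sum_add_distrib]
    refine Finset.sum_congr rfl fun v _ => ?_
    simp [glue_dist_r h₁ h₂, v.2]

open Classical in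
lemma htB_glue {A : Finset V} {G₁ : SimpleGraph {x // x ∈ A}} {G₂ : SimpleGraph {x // x ∉ A}}
    {r : {x // x ∈ A}} {c : {x // x ∉ A}} (h₁ : G₁.IsTree) (h₂ : G₂.IsTree) :
    ∑ v : {x // x ∉ A}, (glue A G₁ G₂ r c).dist v c = ht (G₂, c) := by
  unfold ht
  refine Finset.sum_congr rfl fun v _ => ?_
  simp [glue_dist_c h₁ h₂, v.2]

open Classical in
lemma dart_sum (Φ : ℕ → ℕ → ℕ → ℝ) :
    ∑ p ∈ rt V, ∑ c ∈ univ.filter (fun c => p.1.Adj p.2 c),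
      Φ (ht p) (Fintype.card {x // x ∉ side p.1 p.2 c})
        (∑ v : {x // x ∉ side p.1 p.2 c}, p.1.dist v c) =
    ∑ A : Finset V, ∑ p ∈ rt {x // x ∈ A}, ∑ q ∈ rt {x // x ∉ A},
      Φ (ht p + (ht q + Fintype.card {x // x ∉ A})) (Fintype.card {x // x ∉ A}) (ht q) := by
  have : ∀ A : Finset V, ∑ p ∈ rt {x // x ∈ A}, ∑ q ∈ rt {x // x ∉ A},
      Φ (ht p + (ht q + Fintype.card {x // x ∉ A})) (Fintype.card {x // x ∉ A}) (ht q) =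
      ∑ z ∈ rt {x // x ∈ A} ×ˢ rt {x // x ∉ A}, 
      Φ (ht z.1 + (ht z.2 + Fintype.card {x // x ∉ A})) (Fintype.card {x // x ∉ A}) (ht z.2) := by
    intro A
    rw [Finset.sum_product]
  simp_rw [this]
  rw [Finset.sum_sigma', Finset.sum_sigma']
  symm
  refine Finset.sum_nbij (fun z => ⟨(glue z.1 z.2.1.1 z.2.2.1 z.2.1.2 z.2.2.2, (z.2.1.2 : V)),
    (z.2.2.2 : V)⟩) ?_ ?_ ?_ ?_
  · rintro ⟨A, ⟨G₁, r⟩, ⟨G₂, c⟩⟩ h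
    simp only [Finset.mem_sigma, Finset.mem_univ, Finset.mem_product, mem_rt, true_and,
      Finset.mem_filter] at *
    exact ⟨glue_tree h.1 h.2, glue_adj_rc⟩
  · rintro ⟨A, ⟨G₁, r⟩, ⟨G₂, c⟩⟩ h ⟨A', ⟨G₁', r'⟩, ⟨G₂', c'⟩⟩ h' he
    simp only [Finset.mem_coe, Finset.mem_sigma, Finset.mem_univ, Finset.mem_product, mem_rt,
      true_and, Sigma.mk.injEq, Prod.mk.injEq, heq_eq_eq] at h h' he
    obtain ⟨⟨hg, hr⟩, hc⟩ := he
    have hA : A = A' := by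
      rw [← glue_side (r := r) (c := c) h.1 h.2, ← glue_side (r := r') (c := c') h'.1 h'.2, hg,
        hr, hc]
    subst hA
    have h1 : G₁ = G₁' := by
      rw [← glue_comapL (G₁ := G₁) (G₂ := G₂) (r := r) (c := c), hg, glue_comapL]
    have h2 : G₂ = G₂' := by
      rw [← glue_comapR (G₁ := G₁) (G₂ := G₂) (r := r) (c := c), hg, glue_comapR]
    have h3 := Subtype.ext hr
    have h4 := Subtype.ext hc
    subst h1 h2 h3 h4
    rfl
  · rintro ⟨⟨G, r⟩, c⟩ h
    simp only [Finset.mem_coe, Finset.mem_sigma, Finset.mem_univ, mem_rt,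
      true_and, Finset.mem_filter] at h
    obtain ⟨hG, ha⟩ := h
    have hr : r ∈ side G r c := by simp [side, dist_eq_one_iff_adj.2 ha]
    have hc : c ∉ side G r c := by simp [side]
    refine ⟨⟨side G r c, ((G.comap (fun x : {x // x ∈ side G r c} => (x : V))), ⟨r, hr⟩),
      ((G.comap (fun x : {x // x ∉ side G r c} => (x : V))), ⟨c, hc⟩)⟩, ?_, ?_⟩
    · simp only [Finset.mem_coe, Finset.mem_sigma, Finset.mem_univ, Finset.mem_product, mem_rt,
        true_and]
      exact ⟨split_left hG ha, split_right hG ha⟩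
    · simp only [glue_split hG ha hr hc]
  · rintro ⟨A, ⟨G₁, r⟩, ⟨G₂, c⟩⟩ h
    simp only [Finset.mem_sigma, Finset.mem_univ, Finset.mem_product, mem_rt, true_and] at h
    simp only
    rw [ht_glue h.1 h.2]
    have hs := glue_side (r := r) (c := c) h.1 h.2
    rw [hs, htB_glue h.1 h.2]

open Classical in
lemma sum_children {G : SimpleGraph V} (hG : G.IsTree) (r : V) (f : V → ℕ) (g : V → V → ℕ)
    (hfg : ∀ v c, G.Adj r c → G.dist v c < G.dist v r → g v c = f v) (hr : f r = 0) :
    ∑ c ∈ univ.filter (fun c => G.Adj r c), ∑ v : {x // x ∉ side G r c}, g v c = ∑ v, f v := by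
  have h1 : ∀ c ∈ univ.filter (fun c => G.Adj r c), ∑ v : {x // x ∉ side G r c}, g v c =
      ∑ v, if G.dist v c < G.dist v r then f v else 0 := by
    intro c hc
    simp only [Finset.mem_filter, Finset.mem_univ, true_and] at hc
    rw [← Finset.sum_filter]
    rw [← Finset.sum_subtype (univ.filter fun v => G.dist v c < G.dist v r) ?_ (fun v => g v c)]
    · refine Finset.sum_congr rfl fun v hv => ?_
      simp only [Finset.mem_filter, Finset.mem_univ, true_and] at hv
      exact hfg v c hc hv
    · intro v
      have := hG.dist_ne_of_adj v hc
      simp only [side, Finset.mem_filter, Finset.mem_univ, true_and]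
      omega
  rw [Finset.sum_congr rfl h1, Finset.sum_comm]
  refine Finset.sum_congr rfl fun v _ => ?_
  by_cases h : v = r
  · subst h; simp [hr]
  · obtain ⟨c, hc, hu⟩ := unique_child hG h
    rw [Finset.sum_eq_single c]
    · simp [hc.2]
    · intro b hb hne
      simp only [Finset.mem_filter, Finset.mem_univ, true_and] at hb
      rw [if_neg]
      intro hlt
      exact hne (hu b ⟨hb, hlt⟩)
    · intro hn
      simp [hc.1] at hn

open Classical in
lemma sum_children_ht (p : SimpleGraph V × V) (hG : p.1.IsTree) :
    ∑ c ∈ univ.filter (fun c => p.1.Adj p.2 c), (Fintype.card {x // x ∉ side p.1 p.2 c} + 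
      ∑ v : {x // x ∉ side p.1 p.2 c}, p.1.dist v c) = ht p := by
  unfold ht
  rw [← sum_children hG p.2 (fun v => p.1.dist v p.2) (fun v c => 1 + p.1.dist v c)]
  · refine Finset.sum_congr rfl fun c _ => ?_
    rw [Finset.sum_add_distrib]
    simp
  · intro v c ha hd
    have h2 := hG.1.dist_triangle (u := v) (v := c) (w := p.2)
    rw [dist_eq_one_iff_adj.2 ha.symm] at h2
    omega
  · simp

open Classical in
lemma sum_children_card (p : SimpleGraph V × V) (hG : p.1.IsTree) :
    ∑ c ∈ univ.filter (fun c => p.1.Adj p.2 c), (Fintype.card {x // x ∉ side p.1 p.2 c}) + 1 =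
      Fintype.card V := by
  have := sum_children hG p.2 (fun v => if v = p.2 then 0 else 1) (fun v c => 1) ?_ ?_
  · simp only [Finset.sum_const, smul_eq_mul, mul_one, Finset.card_univ] at this
    rw [this]
    have h2 : ∑ v : V, (if v = p.2 then 0 else 1) + ∑ v : V, (if v = p.2 then 1 else 0) =
        Fintype.card V := by
      rw [← Finset.sum_add_distrib, ← Finset.card_univ, Finset.card_eq_sum_ones]
      refine Finset.sum_congr rfl fun v _ => ?_
      split_ifs <;> rfl
    simpa using h2
  · intro v c ha hd
    rw [if_neg]
    rintro rfl
    simp at hd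
  · simp

/-- shifted moment sums -/
noncomputable def Gm (k n : ℕ) : ℝ := ∑ p ∈ rt (Fin n), ((ht p : ℝ) + n) ^ k

open Classical in
lemma conv_sum (n : ℕ) (hV : Fintype.card V = n) (Φ : ℕ → ℕ → ℕ → ℝ) :
    ∑ A : Finset V, ∑ p ∈ rt {x // x ∈ A}, ∑ q ∈ rt {x // x ∉ A},
      Φ (ht p + (ht q + Fintype.card {x // x ∉ A})) (Fintype.card {x // x ∉ A}) (ht q) =
    ∑ j ∈ range (n + 1), (n.choose j : ℝ) * ∑ p ∈ rt (Fin j), ∑ q ∈ rt (Fin (n - j)),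
      Φ (ht p + (ht q + (n - j))) (n - j) (ht q) := by
  have h1 : ∀ A : Finset V, ∑ p ∈ rt {x // x ∈ A}, ∑ q ∈ rt {x // x ∉ A},
      Φ (ht p + (ht q + Fintype.card {x // x ∉ A})) (Fintype.card {x // x ∉ A}) (ht q) =
      (fun j => ∑ p ∈ rt (Fin j), ∑ q ∈ rt (Fin (n - j)),
      Φ (ht p + (ht q + (n - j))) (n - j) (ht q)) A.card := by
    intro A
    have hc : Fintype.card {x // x ∉ A} = n - A.card := by
      rw [Fintype.card_subtype_compl, hV, Fintype.card_coe]
    rw [hc]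
    dsimp only
    rw [← sum_rt_card A.card (Fintype.card_coe A) (fun a => ∑ q ∈ rt (Fin (n - A.card)),
      Φ (a + (ht q + (n - A.card))) (n - A.card) (ht q))]
    refine Finset.sum_congr rfl fun p _ => ?_
    rw [sum_rt_card (n - A.card) hc (fun a => 
      Φ (ht p + (a + (n - A.card))) (n - A.card) a)]
  rw [Finset.sum_congr rfl (fun A _ => h1 A)]
  rw [← Finset.powerset_univ, Finset.sum_powerset_apply_card (fun j => ∑ p ∈ rt (Fin j),
    ∑ q ∈ rt (Fin (n - j)), Φ (ht p + (ht q + (n - j))) (n - j) (ht q)), Finset.card_univ, hV]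
  simp only [nsmul_eq_mul]

open Classical in
lemma dart_conv (n : ℕ) (hV : Fintype.card V = n) (Φ : ℕ → ℕ → ℕ → ℝ) :
    ∑ p ∈ rt V, ∑ c ∈ univ.filter (fun c => p.1.Adj p.2 c),
      Φ (ht p) (Fintype.card {x // x ∉ side p.1 p.2 c})
        (∑ v : {x // x ∉ side p.1 p.2 c}, p.1.dist v c) =
    ∑ j ∈ range (n + 1), (n.choose j : ℝ) * ∑ p ∈ rt (Fin j), ∑ q ∈ rt (Fin (n - j)),
      Φ (ht p + (ht q + (n - j))) (n - j) (ht q) :=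
  (dart_sum Φ).trans (conv_sum n hV Φ)

lemma rec0V (n : ℕ) (hV : Fintype.card V = n) : ((n : ℝ) - 1) * S 0 n = ∑ j ∈ range (n + 1), (n.choose j : ℝ) *
    (S 0 j * (((n - j : ℕ) : ℝ) * S 0 (n - j))) := by
  classical
  have h := dart_conv (V := V) n hV (fun _ m _ => (m : ℝ))
  have hl : ∑ p ∈ rt V, ∑ c ∈ univ.filter (fun c => p.1.Adj p.2 c),
      (Fintype.card {x // x ∉ side p.1 p.2 c} : ℝ) = ((n : ℝ) - 1) * S 0 n := by
    unfold S
    rw [← sum_rt_card n hV (fun a => (a : ℝ) ^ 0), Finset.mul_sum]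
    refine Finset.sum_congr rfl fun p hp => ?_
    have := sum_children_card p ((mem_rt p).1 hp)
    rw [hV] at this
    rw [← Nat.cast_sum]
    have h3 : (n : ℝ) = ((∑ c ∈ univ.filter (fun c => p.1.Adj p.2 c),
      (Fintype.card {x // x ∉ side p.1 p.2 c}) + 1 : ℕ) : ℝ) := by rw [this]
    rw [h3, Nat.cast_add]
    simp
  rw [← hl, h]
  refine Finset.sum_congr rfl fun j _ => ?_
  simp only [S, pow_zero, Finset.sum_const, nsmul_eq_mul, mul_one]
  ring

lemma reckV (k n : ℕ) (hV : Fintype.card V = n) : S (k + 1) n = ∑ j ∈ range (n + 1), (n.choose j : ℝ) *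
    ∑ a ∈ range (k + 1), (k.choose a : ℝ) * S a j * Gm (k - a + 1) (n - j) := by
  classical
  have h := dart_conv (V := V) n hV (fun t m b => (t : ℝ) ^ k * ((m : ℝ) + b))
  have hl : ∑ p ∈ rt V, ∑ c ∈ univ.filter (fun c => p.1.Adj p.2 c),
      ((ht p : ℝ) ^ k * ((Fintype.card {x // x ∉ side p.1 p.2 c} : ℝ) +
        ((∑ v : {x // x ∉ side p.1 p.2 c}, p.1.dist v c : ℕ) : ℝ))) = S (k + 1) n := by
    unfold S
    rw [← sum_rt_card n hV (fun a => (a : ℝ) ^ (k + 1))]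
    refine Finset.sum_congr rfl fun p hp => ?_
    have := sum_children_ht p ((mem_rt p).1 hp)
    rw [← Finset.mul_sum, pow_succ]
    congr 1
    have h3 : (ht p : ℝ) = ((∑ c ∈ univ.filter (fun c => p.1.Adj p.2 c),
      (Fintype.card {x // x ∉ side p.1 p.2 c} +
        ∑ v : {x // x ∉ side p.1 p.2 c}, p.1.dist v c) : ℕ) : ℝ) := by rw [this]
    rw [h3, Nat.cast_sum]
    refine Finset.sum_congr rfl fun c _ => ?_
    rw [Nat.cast_add]
  rw [← hl, h]
  refine Finset.sum_congr rfl fun j _ => ?_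
  congr 1
  have : ∀ a, (k.choose a : ℝ) * S a j * Gm (k - a + 1) (n - j) = ∑ p ∈ rt (Fin j),
      ∑ q ∈ rt (Fin (n - j)), (k.choose a : ℝ) * (ht p : ℝ) ^ a *
        ((ht q : ℝ) + (n - j : ℕ)) ^ (k - a + 1) := by
    intro a
    unfold S Gm
    rw [mul_assoc, Finset.sum_mul_sum, Finset.mul_sum]
    refine Finset.sum_congr rfl fun p _ => ?_
    rw [Finset.mul_sum]
    refine Finset.sum_congr rfl fun q _ => ?_
    ring
  simp_rw [this]
  symm
  rw [Finset.sum_comm]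
  refine Finset.sum_congr rfl fun p _ => ?_
  rw [Finset.sum_comm]
  refine Finset.sum_congr rfl fun q _ => ?_
  rw [Nat.cast_add, Nat.cast_add, add_pow, Finset.sum_mul]
  refine Finset.sum_congr rfl fun a _ => ?_
  ring

lemma rec0 (n : ℕ) : ((n : ℝ) - 1) * S 0 n = ∑ j ∈ range (n + 1), (n.choose j : ℝ) *
    (S 0 j * (((n - j : ℕ) : ℝ) * S 0 (n - j))) := rec0V (V := Fin n) n (Fintype.card_fin n)

lemma reck (k n : ℕ) : S (k + 1) n = ∑ j ∈ range (n + 1), (n.choose j : ℝ) *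
    ∑ a ∈ range (k + 1), (k.choose a : ℝ) * S a j * Gm (k - a + 1) (n - j) :=
  reckV (V := Fin n) k n (Fintype.card_fin n)

lemma S_zero_zero : S 0 0 = 0 := by
  unfold S
  apply Finset.sum_eq_zero
  intro p
  exact p.2.elim0

lemma S_zero_one : S 0 1 = 1 := by
  classical
  have : rt (Fin 1) = {(⊥, 0)} := by
    ext p
    rw [mem_rt, Finset.mem_singleton]
    constructor
    · intro _
      ext x y
      · simp [Subsingleton.elim x y]
      · simp
    · intro _
      exact IsTree.of_subsingleton
  unfold S
  rw [this]
  simp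

lemma S_empty (k : ℕ) : S k 0 = 0 := by
  unfold S
  apply Finset.sum_eq_zero
  intro p
  exact p.2.elim0

lemma Gm_eq (k n : ℕ) : Gm k n = ∑ b ∈ range (k + 1), (k.choose b : ℝ) * ((n : ℝ) ^ b *
    S (k - b) n) := by
  unfold Gm S
  simp_rw [Finset.mul_sum]
  rw [Finset.sum_comm]
  refine Finset.sum_congr rfl fun p _ => ?_
  rw [add_comm, add_pow]
  refine Finset.sum_congr rfl fun p _ => ?_
  ring

end TH

end

section
namespace TH
open Finset PowerSeries

/-- exponential generating function -/
noncomputable def egf (f : ℕ → ℝ) : PowerSeries ℝ := PowerSeries.mk fun n => f n / (n.factorial : ℝ)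

lemma coeff_egf (f : ℕ → ℝ) (n : ℕ) : coeff n (egf f) = f n / (n.factorial : ℝ) := by
  simp [egf]

lemma egf_mul (f g : ℕ → ℝ) : egf (fun n => ∑ j ∈ range (n + 1), (n.choose j : ℝ) *
    (f j * g (n - j))) = egf f * egf g := by
  ext n
  rw [coeff_mul, coeff_egf, Finset.Nat.sum_antidiagonal_eq_sum_range_succ
    (fun i j => coeff i (egf f) * coeff j (egf g)), Finset.sum_div]
  refine Finset.sum_congr rfl fun j hj => ?_
  rw [Finset.mem_range, Nat.lt_succ_iff] at hj
  rw [coeff_egf, coeff_egf, Nat.cast_choose ℝ hj]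
  have h1 : (n.factorial : ℝ) ≠ 0 := by positivity
  have h2 : (j.factorial : ℝ) ≠ 0 := by positivity
  have h3 : ((n - j).factorial : ℝ) ≠ 0 := by positivity
  field_simp

/-- Euler operator -/
noncomputable def D : Derivation ℝ (PowerSeries ℝ) (PowerSeries ℝ) :=
  (X : PowerSeries ℝ) • PowerSeries.derivative ℝ

lemma D_apply (f : PowerSeries ℝ) : D f = X * PowerSeries.derivative ℝ f := rfl

lemma coeff_D (f : PowerSeries ℝ) (n : ℕ) : coeff n (D f) = n * coeff n f := by
  rw [D_apply]
  cases n with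
  | zero => simp
  | succ n => 
    rw [coeff_succ_X_mul, coeff_derivative]
    push_cast
    ring

lemma coeff_D_iter (f : PowerSeries ℝ) (b n : ℕ) :
    coeff n ((⇑D)^[b] f) = (n : ℝ) ^ b * coeff n f := by
  induction b with
  | zero => simp
  | succ b ih =>
    rw [Function.iterate_succ_apply', coeff_D, ih]
    ring

noncomputable def F (k : ℕ) : PowerSeries ℝ := egf (S k)

noncomputable def Gs (k : ℕ) : PowerSeries ℝ := egf (Gm k)

lemma Gs_eq (k : ℕ) : Gs k = ∑ b ∈ range (k + 1), (k.choose b : ℝ) • (⇑D)^[b] (F (k - b)) := by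
  ext n
  rw [map_sum, Gs, coeff_egf, Gm_eq, Finset.sum_div]
  refine Finset.sum_congr rfl fun b _ => ?_
  rw [map_smul, coeff_D_iter, F, coeff_egf, smul_eq_mul]
  ring

lemma F_succ (k : ℕ) : F (k + 1) = ∑ a ∈ range (k + 1), (k.choose a : ℝ) •
    (F a * Gs (k - a + 1)) := by
  unfold F Gs
  simp_rw [← egf_mul]
  ext n
  simp only [map_sum, map_smul, coeff_egf, smul_eq_mul]
  rw [reck, Finset.sum_div]
  simp_rw [Finset.sum_div, Finset.mul_sum, Finset.sum_div]
  rw [Finset.sum_comm]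
  refine Finset.sum_congr rfl fun b _ => ?_
  refine Finset.sum_congr rfl fun b _ => ?_
  ring

/-- tree function -/
noncomputable def T : PowerSeries ℝ := F 0

lemma T_eq : D T = T + T * D T := by
  have h : D T = egf (fun n => n * S 0 n) := by
    ext n
    rw [coeff_D, coeff_egf, T, F, coeff_egf]; ring
  nth_rewrite 2 [h]
  unfold T F
  rw [← egf_mul]
  ext n
  rw [coeff_D, map_add, coeff_egf, coeff_egf, ← rec0]
  ring

noncomputable def U : PowerSeries ℝ := 1 + D T

lemma U_mul : U * (1 - T) = 1 := by
  unfold U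
  linear_combination T_eq

lemma D_T : D T = U - 1 := by simp [U]

lemma T_U : T * U = U - 1 := by linear_combination -U_mul

lemma D_U : D U = U ^ 3 - U ^ 2 := by
  have h := congrArg D U_mul
  rw [Derivation.leibniz, map_sub, Derivation.map_one_eq_zero, D_T] at h
  simp only [smul_eq_mul] at h
  linear_combination U * h - D U * U_mul + (U ^ 2 - U ^ 2) * U_mul

noncomputable def E : PowerSeries ℝ := PowerSeries.mk fun n => coeff (n + 1) T

lemma coeff_T_zero : coeff 0 T = 0 := by
  rw [T, F, coeff_egf, S_empty]; simp

lemma T_XE : T = X * E := by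
  ext n
  cases n with
  | zero => rw [coeff_T_zero]; simp
  | succ n => rw [coeff_succ_X_mul, E, coeff_mk]

lemma coeff_E_zero : coeff 0 E = 1 := by
  rw [E, coeff_mk, T, F, coeff_egf, S_zero_one]; simp

lemma D_E : D E = E * (U - 1) := by
  have h := T_eq
  rw [D_T] at h
  have h2 : D T = X * E + X * D E := by
    rw [T_XE, Derivation.leibniz, smul_eq_mul, smul_eq_mul]
    have : D (X : PowerSeries ℝ) = X := by rw [D_apply]; simp
    rw [this]; ring
  rw [D_T, h, T_XE] at h2
  have hX : (X : PowerSeries ℝ) ≠ 0 := X_ne_zero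
  apply mul_left_cancel₀ hX
  linear_combination -h2

lemma D_E_pow (m : ℕ) : D (E ^ m) = (m : PowerSeries ℝ) * (X * (E ^ (m + 1) * U)) := by
  rw [Derivation.leibniz_pow, D_E]
  have h := T_U
  rw [T_XE] at h
  cases m with
  | zero => simp
  | succ m =>
    simp only [nsmul_eq_mul, smul_eq_mul, Nat.add_sub_cancel]
    linear_combination -((m + 1 : ℕ) : PowerSeries ℝ) * E ^ (m + 1) * h

lemma E_U (m : ℕ) : E ^ m * U = E ^ m + X * (E ^ (m + 1) * U) := by
  have h := T_U
  rw [T_XE] at h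
  linear_combination -E ^ m * h

lemma coeff_U_zero : coeff 0 U = 1 := by
  rw [U, map_add, coeff_D]; simp

lemma coeff_E_U (n : ℕ) : ∀ m : ℕ, coeff n (E ^ m * U) = ((m : ℝ) + n) ^ n / n.factorial := by
  induction n with
  | zero =>
    intro m
    have h1 := coeff_E_zero
    have h2 := coeff_U_zero
    rw [coeff_zero_eq_constantCoeff_apply] at *
    simp [h1, h2]
  | succ n ih =>
    intro m
    have h1 := congrArg (coeff (n + 1)) (E_U m)
    have h2 := congrArg (coeff (n + 1)) (D_E_pow m)
    rw [map_add, coeff_succ_X_mul, ih] at h1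
    have h3 : (m : PowerSeries ℝ) = C (m : ℝ) := by simp
    rw [coeff_D, h3, coeff_C_mul, coeff_succ_X_mul, ih] at h2
    rw [h1]
    have h4 : coeff (n + 1) (E ^ m) = (m : ℝ) * (((m + 1 : ℕ) : ℝ) + n) ^ n / n.factorial /
        ((n : ℝ) + 1) := by
      field_simp
      field_simp at h2
      push_cast at h2 ⊢
      linear_combination h2
    rw [h4, Nat.factorial_succ]
    push_cast
    have h5 : (n.factorial : ℝ) ≠ 0 := by positivity
    have h6 : (n : ℝ) + 1 ≠ 0 := by positivity
    field_simp
    ring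

lemma coeff_U (n : ℕ) : coeff n U = (n : ℝ) ^ n / n.factorial := by
  have := coeff_E_U n 0
  simpa using this

lemma coeff_E_U2 (n : ℕ) : ∀ m : ℕ, coeff n (E ^ m * U ^ 2) =
    ∑ j ∈ range (n + 1), ((m : ℝ) + n) ^ j / j.factorial := by
  induction n with
  | zero =>
    intro m
    have h1 := coeff_E_zero
    have h2 := coeff_U_zero
    rw [coeff_zero_eq_constantCoeff_apply] at *
    simp [h1, h2]
  | succ n ih =>
    intro m
    have h0 : E ^ m * U ^ 2 = E ^ m * U + X * (E ^ (m + 1) * U ^ 2) := by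
      linear_combination U * E_U m
    rw [h0, map_add, coeff_succ_X_mul, ih, coeff_E_U, Finset.sum_range_succ _ (n + 1), add_comm]
    push_cast
    congr 1
    refine Finset.sum_congr rfl fun j _ => ?_
    ring

lemma coeff_U2 (n : ℕ) : coeff n (U ^ 2) = ∑ j ∈ range (n + 1), (n : ℝ) ^ j / j.factorial := by
  have := coeff_E_U2 n 0
  simpa using this

lemma coeff_U_step (b n : ℕ) (hb : b ≠ 0) : coeff n (U ^ (b + 2)) =
    n * coeff n (U ^ b) / b + coeff n (U ^ (b + 1)) := by
  have h : D (U ^ b) = (b : PowerSeries ℝ) * (U ^ (b + 2) - U ^ (b + 1)) := by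
    rw [Derivation.leibniz_pow, D_U]
    obtain ⟨b, rfl⟩ := Nat.exists_eq_succ_of_ne_zero hb
    simp only [nsmul_eq_mul, smul_eq_mul, Nat.succ_eq_add_one, Nat.add_sub_cancel]
    ring
  have h2 := congrArg (coeff n) h
  have h3 : (b : PowerSeries ℝ) = C (b : ℝ) := by simp
  rw [coeff_D, h3, coeff_C_mul, map_sub] at h2
  rw [h2]
  have : (b : ℝ) ≠ 0 := by exact_mod_cast hb
  field_simp
  ring

/-- polynomial in `U` of degree at most `d` with top coefficient `l` -/
def Pd (d : ℕ) (l : ℝ) (f : PowerSeries ℝ) : Prop :=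
  ∃ p : Polynomial ℝ, p.natDegree ≤ d ∧ p.coeff d = l ∧ f = Polynomial.aeval U p

lemma Pd.add {d : ℕ} {l m : ℝ} {f g : PowerSeries ℝ} (hf : Pd d l f) (hg : Pd d m g) :
    Pd d (l + m) (f + g) := by
  obtain ⟨p, hp, hl, rfl⟩ := hf
  obtain ⟨q, hq, hm, rfl⟩ := hg
  exact ⟨p + q, Polynomial.natDegree_add_le_of_degree_le hp hq, by simp [hl, hm], by simp⟩

lemma Pd.mul {d e : ℕ} {l m : ℝ} {f g : PowerSeries ℝ} (hf : Pd d l f) (hg : Pd e m g) :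
    Pd (d + e) (l * m) (f * g) := by
  obtain ⟨p, hp, hl, rfl⟩ := hf
  obtain ⟨q, hq, hm, rfl⟩ := hg
  exact ⟨p * q, Polynomial.natDegree_mul_le_of_le hp hq, by
    rw [Polynomial.coeff_mul_add_eq_of_natDegree_le hp hq, hl, hm], by simp⟩

lemma Pd.smul {d : ℕ} {l : ℝ} {f : PowerSeries ℝ} (a : ℝ) (hf : Pd d l f) :
    Pd d (a * l) (a • f) := by
  obtain ⟨p, hp, hl, rfl⟩ := hf
  exact ⟨a • p, (Polynomial.natDegree_smul_le a p).trans hp, by simp [hl], by simp⟩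

lemma Pd.raise {d e : ℕ} {l : ℝ} {f : PowerSeries ℝ} (h : d < e) (hf : Pd d l f) :
    Pd e 0 f := by
  obtain ⟨p, hp, hl, rfl⟩ := hf
  exact ⟨p, hp.trans h.le, Polynomial.coeff_eq_zero_of_natDegree_lt (hp.trans_lt h), rfl⟩

lemma Pd_U : Pd 1 1 U := ⟨Polynomial.X, by simp, by simp, by simp⟩

lemma Pd_U1 : Pd 1 1 (U - 1) :=
  ⟨Polynomial.X - 1, by simpa using Polynomial.natDegree_X_sub_C_le (1 : ℝ), by
    simp [Polynomial.coeff_one], by simp⟩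

lemma Pd.D {d : ℕ} {l : ℝ} {f : PowerSeries ℝ} (hf : Pd d l f) (hd : d ≠ 0) :
    Pd (d + 2) (d * l) (D f) := by
  obtain ⟨p, hp, hl, rfl⟩ := hf
  obtain ⟨d, rfl⟩ := Nat.exists_eq_succ_of_ne_zero hd
  have h1 : Pd d ((d + 1 : ℕ) * l) (Polynomial.aeval U (Polynomial.derivative p)) := by
    refine ⟨_, (Polynomial.natDegree_derivative_le p).trans (by omega), ?_, rfl⟩
    rw [Polynomial.coeff_derivative, ← hl]
    push_cast
    ring
  have h2 : Pd 3 1 (U ^ 3 - U ^ 2) := by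
    refine ⟨Polynomial.X ^ 3 - Polynomial.X ^ 2, by compute_degree, ?_, by simp⟩
    simp [Polynomial.coeff_X_pow]
  have h3 := h1.mul h2
  rw [mul_one] at h3
  rw [Derivation.map_aeval, D_U, smul_eq_mul]
  exact h3

end TH

end

section
namespace TH
open Finset PowerSeries

lemma Pd.sum {ι : Type*} {d : ℕ} (s : Finset ι) (l : ι → ℝ) (f : ι → PowerSeries ℝ)
    (h : ∀ i ∈ s, Pd d (l i) (f i)) : Pd d (∑ i ∈ s, l i) (∑ i ∈ s, f i) := by
  classical
  induction s using Finset.induction_on with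
  | empty => exact ⟨0, by simp, by simp, by simp⟩
  | insert a s ha ih =>
    rw [Finset.sum_insert ha, Finset.sum_insert ha]
    exact (h a (Finset.mem_insert_self a s)).add
      (ih fun i hi => h i (Finset.mem_insert_of_mem hi))

lemma Pd.iter {d : ℕ} {l : ℝ} {f : PowerSeries ℝ} (hf : Pd d l f) (hd : d ≠ 0) (b : ℕ) :
    ∃ m, Pd (d + 2 * b) m ((⇑TH.D)^[b] f) := by
  induction b with
  | zero => exact ⟨l, hf⟩
  | succ b ih =>
    obtain ⟨m, hm⟩ := ih
    refine ⟨((d + 2 * b : ℕ) : ℝ) * m, ?_⟩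
    rw [Function.iterate_succ_apply']
    exact hm.D (by omega)

/-- lower order part of the shifted series -/
noncomputable def R (k : ℕ) : PowerSeries ℝ :=
  ∑ b ∈ range k, (k.choose (b + 1) : ℝ) • (⇑D)^[b + 1] (F (k - (b + 1)))

lemma Gs_R (k : ℕ) : Gs k = F k + R k := by
  rw [Gs_eq, Finset.sum_range_succ', R, add_comm]
  simp

lemma F_solve (k : ℕ) : F (k + 1) = (U - 1) * R (k + 1) + U *
    ∑ a ∈ range k, (k.choose (a + 1) : ℝ) • (F (a + 1) * Gs (k - (a + 1) + 1)) := by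
  have h := F_succ k
  rw [Finset.sum_range_succ'] at h
  simp only [Nat.choose_zero_right, Nat.cast_one, one_smul, Nat.sub_zero] at h
  rw [Gs_R (k + 1)] at h
  change _ = _ + T * _ at h
  linear_combination U * h - F (k + 1) * U_mul + R (k + 1) * T_U

lemma DT_Pd : Pd 1 1 (D T) := by rw [D_T]; exact Pd_U1

lemma F_one : Pd 2 1 (F 1) := by
  have h := F_solve 0
  have : R 1 = D T := by simp [R, T]
  simp only [Finset.range_zero, Finset.sum_empty, mul_zero, add_zero, zero_add] at h
  rw [h, this]
  simpa using Pd_U1.mul DT_Pd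

lemma R_Pd (k : ℕ) (l : ℕ → ℝ) (h : ∀ j ≤ k, Pd (3 * j + 2) (l j) (F (j + 1))) :
    Pd (3 * k + 4) ((k + 2) * ((3 * k + 2) * l k)) (R (k + 2)) := by
  rw [R, Finset.sum_range_succ']
  have h1 : Pd (3 * k + 4) ((k + 2) * ((3 * k + 2) * l k)) (((k + 2).choose (0 + 1) : ℝ) •
      (⇑D)^[0 + 1] (F (k + 2 - (0 + 1)))) := by
    have := ((h k le_rfl).D (by omega)).smul ((k + 2).choose (0 + 1) : ℝ)
    simpa using this
  have h2 := Pd.sum (d := 3 * k + 4) (range (k + 1)) (fun _ => 0)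
    (fun b => ((k + 2).choose (b + 1 + 1) : ℝ) • (⇑D)^[b + 1 + 1] (F (k + 2 - (b + 1 + 1)))) ?_
  · simpa using h2.add h1
  · intro b hb
    rw [Finset.mem_range] at hb
    suffices hs : ∃ d m, d < 3 * k + 4 ∧ Pd d m ((⇑D)^[b + 1 + 1] (F (k + 2 - (b + 1 + 1)))) by
      obtain ⟨d, m, hd, hP⟩ := hs
      exact (hP.smul _).raise hd
    by_cases hk : b = k
    · subst hk
      obtain ⟨m, hm⟩ := DT_Pd.iter (by omega) (b + 1)
      refine ⟨1 + 2 * (b + 1), m, by omega, ?_⟩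
      · have : b + 2 - (b + 1 + 1) = 0 := by omega
        rw [this, Function.iterate_succ_apply]
        exact hm
    · obtain ⟨m, hm⟩ := (h (k - (b + 1)) (by omega)).iter (by omega) (b + 1 + 1)
      refine ⟨3 * (k - (b + 1)) + 2 + 2 * (b + 1 + 1), m, by omega, ?_⟩
      · have : k + 2 - (b + 1 + 1) = k - (b + 1) + 1 := by omega
        rw [this]
        exact hm

lemma Gs_Pd (k : ℕ) (l : ℕ → ℝ) (h : ∀ j ≤ k, Pd (3 * j + 2) (l j) (F (j + 1))) :
    Pd (3 * k + 2) (l k) (Gs (k + 1)) := by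
  rw [Gs_R, ← add_zero (l k)]
  refine (h k le_rfl).add ?_
  cases k with
  | zero =>
    have : R 1 = D T := by simp [R, T]
    rw [zero_add, this]
    exact DT_Pd.raise (by omega)
  | succ k => exact (R_Pd k l fun j hj => h j (by omega)).raise (by omega)

lemma F_step (k : ℕ) (l : ℕ → ℝ) (h : ∀ j ≤ k, Pd (3 * j + 2) (l j) (F (j + 1))) :
    Pd (3 * (k + 1) + 2) ((k + 2) * ((3 * k + 2) * l k) +
      ∑ a ∈ range (k + 1), ((k + 1).choose (a + 1) : ℝ) * (l a * l (k - a))) (F (k + 1 + 1)) := by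
  rw [F_solve]
  apply Pd.add
  · have := Pd_U1.mul (R_Pd k l h)
    rw [one_mul] at this
    convert this using 1
    ring
  · have h2 := Pd.sum (d := 3 * k + 4) (range (k + 1))
      (fun a => ((k + 1).choose (a + 1) : ℝ) * (l a * l (k - a)))
      (fun a => ((k + 1).choose (a + 1) : ℝ) • (F (a + 1) * Gs (k + 1 - (a + 1) + 1))) ?_
    · have := Pd_U.mul h2
      rw [one_mul] at this
      convert this using 1
      ring
    · intro a ha
      rw [Finset.mem_range] at ha
      have h3 := (h a (by omega)).mul (Gs_Pd (k - a) l fun j hj => h j (by omega))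
      have h4 : k + 1 - (a + 1) = k - a := by omega
      have h5 : 3 * a + 2 + (3 * (k - a) + 2) = 3 * k + 4 := by omega
      rw [h4]
      rw [h5] at h3
      exact h3.smul _

/-- leading coefficients -/
def lc : ℕ → ℝ
  | 0 => 1
  | 1 => 5
  | 2 => 90
  | 3 => 3315
  | _ => 203400

lemma F_Pd : ∀ j ≤ 4, Pd (3 * j + 2) (lc j) (F (j + 1)) := by
  have h0 : ∀ j ≤ 0, Pd (3 * j + 2) (lc j) (F (j + 1)) := by
    intro j hj
    obtain rfl : j = 0 := by omega
    exact F_one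
  have h1 : ∀ j ≤ 1, Pd (3 * j + 2) (lc j) (F (j + 1)) := by
    intro j hj
    rcases Nat.lt_or_eq_of_le hj with hj | rfl
    · exact h0 j (by omega)
    · convert F_step 0 lc h0 using 1
      norm_num [lc, Finset.sum_range_succ]
  have h2 : ∀ j ≤ 2, Pd (3 * j + 2) (lc j) (F (j + 1)) := by
    intro j hj
    rcases Nat.lt_or_eq_of_le hj with hj | rfl
    · exact h1 j (by omega)
    · convert F_step 1 lc h1 using 1
      norm_num [lc, Finset.sum_range_succ, Nat.choose]
  have h3 : ∀ j ≤ 3, Pd (3 * j + 2) (lc j) (F (j + 1)) := by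
    intro j hj
    rcases Nat.lt_or_eq_of_le hj with hj | rfl
    · exact h2 j (by omega)
    · convert F_step 2 lc h2 using 1
      norm_num [lc, Finset.sum_range_succ, Nat.choose]
  intro j hj
  rcases Nat.lt_or_eq_of_le hj with hj | rfl
  · exact h3 j (by omega)
  · convert F_step 3 lc h3 using 1
    norm_num [lc, Finset.sum_range_succ, Nat.choose]

end TH

end

section
namespace TH
open Filter Topology Real MeasureTheory

/-- product form of the terms -/
noncomputable def qt (n j : ℕ) : ℝ := (n.descFactorial j : ℝ) / (n : ℝ) ^ j

lemma qt_prod (n j : ℕ) (hn : 0 < n) (hj : j ≤ n) : qt n j = ∏ i ∈ Finset.range j, (1 - (i : ℝ) / n) := by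
  have hn' : (n : ℝ) ≠ 0 := by positivity
  induction j with
  | zero => simp [qt]
  | succ j ih =>
    rw [Finset.prod_range_succ, ← ih (by omega)]
    unfold qt
    rw [Nat.descFactorial_succ, Nat.cast_mul, Nat.cast_sub (by omega)]
    field_simp
    ring

lemma qt_nonneg (n j : ℕ) : 0 ≤ qt n j := by unfold qt; positivity

lemma qt_le (n j : ℕ) (hn : 0 < n) : qt n j ≤ exp (-((j : ℝ) * (j - 1) / (2 * n))) := by
  by_cases hj : j ≤ n
  · rw [qt_prod n j hn hj]
    have h : ∀ i ∈ Finset.range j, (1 - (i : ℝ) / n) ≤ exp (-((i : ℝ) / n)) := by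
      intro i _
      have := add_one_le_exp (-((i : ℝ) / n))
      linarith
    refine (Finset.prod_le_prod ?_ h).trans ?_
    · intro i hi
      rw [Finset.mem_range] at hi
      have : (i : ℝ) / n ≤ 1 := by
        rw [div_le_one (by positivity)]
        exact_mod_cast (by omega)
      linarith
    · rw [← exp_sum]
      apply le_of_eq
      congr 1
      rw [Finset.sum_neg_distrib, ← Finset.sum_div]
      have : ∑ i ∈ Finset.range j, (i : ℝ) = (j : ℝ) * (j - 1) / 2 := by
        clear hj h
        induction j with
        | zero => simp
        | succ j ih => rw [Finset.sum_range_succ, ih]; push_cast; ring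
      rw [this]
      field_simp
  · have : n.descFactorial j = 0 := Nat.descFactorial_eq_zero_iff_lt.2 (by omega)
    simp only [qt, this, Nat.cast_zero, zero_div]
    positivity

/-- lower bound -/
lemma qt_ge (n j : ℕ) (hn : 0 < n) (hj : 2 * j ≤ n) :
    exp (-((j : ℝ) ^ 2 / (2 * n)) - (j : ℝ) ^ 3 / n ^ 2) ≤ qt n j := by
  have hn' : (0 : ℝ) < n := by positivity
  rw [qt_prod n j hn (by omega)]
  have h : ∀ i ∈ Finset.range j, exp (-((i : ℝ) / n) - ((i : ℝ) / n) ^ 2) ≤ (1 - (i : ℝ) / n) := by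
    intro i hi
    rw [Finset.mem_range] at hi
    set x := (i : ℝ) / n with hx
    have hx0 : 0 ≤ x := by positivity
    have hx1 : x ≤ 1 / 2 := by
      rw [hx, div_le_iff₀ hn']
      have : (2 * i : ℝ) ≤ n := by exact_mod_cast (by omega)
      linarith
    have h1 : 1 + (x + x ^ 2) + (x + x ^ 2) ^ 2 / 2 ≤ exp (x + x ^ 2) :=
      quadratic_le_exp_of_nonneg (by positivity)
    have h2 : exp (-x - x ^ 2) = (exp (x + x ^ 2))⁻¹ := by
      rw [← exp_neg]; congr 1; ring
    rw [h2, inv_le_comm₀ (exp_pos _) (by linarith)]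
    refine le_trans ?_ h1
    rw [inv_le_iff_one_le_mul₀ (by linarith)]
    have hx2 : x ^ 2 ≤ 1 / 4 := by nlinarith
    have hx3 : x ^ 3 ≤ 1 / 8 := by
      have : x ^ 3 = x ^ 2 * x := by ring
      rw [this]; nlinarith [sq_nonneg x]
    nlinarith [mul_nonneg (sq_nonneg x) (by linarith : 0 ≤ 1 - x - x ^ 2 - x ^ 3)]
  refine le_trans ?_ (Finset.prod_le_prod (fun i _ => (exp_pos _).le) h)
  rw [← exp_sum]
  apply exp_le_exp.2
  clear h hj
  induction j with
  | zero => simp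
  | succ j ih =>
    rw [Finset.sum_range_succ]
    refine le_trans ?_ (add_le_add_left ih _)
    rw [← sub_nonneg]
    have : -((j : ℝ) ^ 2 / (2 * n)) - (j : ℝ) ^ 3 / n ^ 2 + (-((j : ℝ) / n) - ((j : ℝ) / n) ^ 2) -
      (-((((j + 1 : ℕ) : ℝ)) ^ 2 / (2 * n)) - ((j + 1 : ℕ) : ℝ) ^ 3 / n ^ 2) =
      1 / (2 * n) + (2 * (j : ℝ) ^ 2 + 3 * j + 1) / n ^ 2 := by
      push_cast
      field_simp
      ring
    rw [this]
    positivity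

lemma U2_ratio (n : ℕ) (hn : 0 < n) : PowerSeries.coeff n (U ^ 2) / PowerSeries.coeff n U =
    ∑ j ∈ Finset.range (n + 1), qt n j := by
  rw [coeff_U2, coeff_U, ← Finset.sum_range_reflect, Finset.sum_div]
  refine Finset.sum_congr rfl fun j hj => ?_
  rw [Finset.mem_range] at hj
  have h1 : n + 1 - 1 - j = n - j := by omega
  rw [h1, qt]
  have h2 := Nat.factorial_mul_descFactorial (n := n) (k := j) (by omega)
  have h3 : (n : ℝ) ^ n = (n : ℝ) ^ (n - j) * (n : ℝ) ^ j := by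
    rw [← pow_add]; congr 1; omega
  rw [h3, ← h2]
  have hn' : (n : ℝ) ≠ 0 := by positivity
  have h4 : ((n - j).factorial : ℝ) ≠ 0 := by positivity
  push_cast
  field_simp

/-- step function -/
noncomputable def gs (n : ℕ) (x : ℝ) : ℝ := qt n ⌊x * √n⌋₊

lemma gs_meas (n : ℕ) : Measurable (gs n) := by
  unfold gs
  have : Measurable (fun x : ℝ => ⌊x * √n⌋₊) := Nat.measurable_floor.comp (by fun_prop)
  exact (measurable_from_nat (f := qt n)).comp this

lemma gs_bound (n : ℕ) (hn : 0 < n) (x : ℝ) :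
    gs n x ≤ exp (3 - x) := by
  refine (qt_le n _ hn).trans (exp_le_exp.2 ?_)
  have hs : 1 ≤ √(n : ℝ) := by
    rw [Real.one_le_sqrt]; exact_mod_cast hn
  have hsq : √(n : ℝ) ^ 2 = n := Real.sq_sqrt (by positivity)
  set s := √(n : ℝ)
  set j : ℝ := (⌊x * s⌋₊ : ℝ)
  have hj : x * s < j + 1 := Nat.lt_floor_add_one _
  have hj0 : 0 ≤ j := by positivity
  rw [← hsq]
  have : x - 3 ≤ j * (j - 1) / (2 * s ^ 2) := by
    rw [le_div_iff₀ (by positivity)]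
    nlinarith [mul_le_mul_of_nonneg_right hj.le (by linarith : 0 ≤ s), sq_nonneg (j - s - 1 / 2), mul_nonneg (by linarith : 0 ≤ s) (by linarith : 0 ≤ s - 1)]
  linarith

lemma gs_lim (x : ℝ) (hx : 0 ≤ x) : Tendsto (fun n => gs n x) atTop (𝓝 (exp (-(x ^ 2 / 2)))) := by
  have hs : Tendsto (fun n : ℕ => √(n : ℝ)) atTop atTop :=
    tendsto_sqrt_atTop.comp tendsto_natCast_atTop_atTop
  have hinv : Tendsto (fun n : ℕ => (√(n : ℝ))⁻¹) atTop (𝓝 0) := tendsto_inv_atTop_zero.comp hs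
  have hj : Tendsto (fun n : ℕ => (⌊x * √(n : ℝ)⌋₊ : ℝ) / √(n : ℝ)) atTop (𝓝 x) := by
    exact (tendsto_nat_floor_mul_div_atTop hx).comp hs
  have hlo : Tendsto (fun n : ℕ => exp (-(((⌊x * √(n : ℝ)⌋₊ : ℝ) / √(n : ℝ)) ^ 2 / 2) -
      ((⌊x * √(n : ℝ)⌋₊ : ℝ) / √(n : ℝ)) ^ 3 * (√(n : ℝ))⁻¹)) atTop (𝓝 (exp (-(x ^ 2 / 2)))) := by
    refine (continuous_exp.tendsto _).comp ?_
    have := (((hj.pow 2).div_const 2).neg).sub ((hj.pow 3).mul hinv)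
    simpa using this
  have hhi : Tendsto (fun n : ℕ => exp (-(((⌊x * √(n : ℝ)⌋₊ : ℝ) / √(n : ℝ)) *
      ((⌊x * √(n : ℝ)⌋₊ : ℝ) / √(n : ℝ) - (√(n : ℝ))⁻¹) / 2))) atTop
        (𝓝 (exp (-(x ^ 2 / 2)))) := by
    refine (continuous_exp.tendsto _).comp ?_
    have := ((hj.mul (hj.sub hinv)).div_const 2).neg
    convert this using 2
    ring
  have hlarge : ∀ᶠ n : ℕ in atTop, 2 * x ≤ √(n : ℝ) := hs.eventually_ge_atTop _
  refine tendsto_of_tendsto_of_tendsto_of_le_of_le' hlo hhi ?_ ?_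
  · filter_upwards [hlarge, eventually_gt_atTop 0] with n hn hn0
    have hsp : 0 < √(n : ℝ) := Real.sqrt_pos.2 (by exact_mod_cast hn0)
    have hsq : √(n : ℝ) ^ 2 = n := Real.sq_sqrt (by positivity)
    have hfl : (⌊x * √(n : ℝ)⌋₊ : ℝ) ≤ x * √(n : ℝ) := Nat.floor_le (by positivity)
    have h2 : 2 * ⌊x * √(n : ℝ)⌋₊ ≤ n := by
      have : (2 : ℝ) * (⌊x * √(n : ℝ)⌋₊ : ℝ) ≤ n := by nlinarith
      exact_mod_cast this
    refine le_trans (le_of_eq ?_) (qt_ge n _ hn0 h2)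
    congr 1
    have h4 : (n : ℝ) ^ 2 = √(n : ℝ) ^ 4 := by rw [← hsq]; simp [hsq]; ring_nf; nlinarith [hsq]
    rw [h4]
    nth_rewrite 7 [← hsq]
    field_simp
  · filter_upwards [eventually_gt_atTop 0] with n hn0
    have hsp : 0 < √(n : ℝ) := Real.sqrt_pos.2 (by exact_mod_cast hn0)
    have hsq : √(n : ℝ) ^ 2 = n := Real.sq_sqrt (by positivity)
    refine (qt_le n _ hn0).trans (le_of_eq ?_)
    congr 2
    nth_rewrite 3 [← hsq]
    field_simp

lemma gs_int_lim : Tendsto (fun n => ∫ x in Set.Ioi (0 : ℝ), gs n x) atTop (𝓝 √(π / 2)) := by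
  have hg : ∫ x in Set.Ioi (0 : ℝ), exp (-(x ^ 2 / 2)) = √(π / 2) := by
    have := integral_gaussian_Ioi (1 / 2)
    have h2 : √(π / (1 / 2)) / 2 = √(π / 2) := by
      have : π / (1 / 2) = 2 ^ 2 * (π / 2) := by ring
      rw [this, Real.sqrt_mul (by positivity), Real.sqrt_sq (by norm_num)]
      ring
    rw [← h2, ← this]
    congr 1
    ext x
    congr 1
    ring
  rw [← hg]
  refine tendsto_integral_filter_of_dominated_convergence (fun x => exp (3 - x)) ?_ ?_ ?_ ?_
  · exact Eventually.of_forall fun n => (gs_meas n).aestronglyMeasurable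
  · filter_upwards [eventually_gt_atTop 0] with n hn
    refine (ae_restrict_iff' measurableSet_Ioi).2 (Eventually.of_forall fun x _ => ?_)
    rw [Real.norm_of_nonneg (show 0 ≤ gs n x from qt_nonneg _ _)]
    exact gs_bound n hn x
  · have : (fun x : ℝ => exp (3 - x)) = fun x => exp 3 * exp (-x) := by
      ext x; rw [← exp_add]; congr 1
    rw [this]
    exact (integrableOn_exp_neg_Ioi 0).const_mul _
  · refine (ae_restrict_iff' measurableSet_Ioi).2 (Eventually.of_forall fun x hx => ?_)
    exact gs_lim x (le_of_lt hx)

end TH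

end

section
namespace TH
open Filter Topology Real MeasureTheory

lemma qt_zero (n j : ℕ) (h : n < j) : qt n j = 0 := by
  have : n.descFactorial j = 0 := Nat.descFactorial_eq_zero_iff_lt.2 h
  simp [qt, this]

lemma unit_int (f : ℕ → ℝ) (k : ℕ) :
    Set.EqOn (fun y : ℝ => f ⌊y⌋₊) (fun _ => f k) (Set.Ico (k : ℝ) ((k + 1 : ℕ) : ℝ)) := by
  intro y hy
  have : ⌊y⌋₊ = k := by
    rw [Nat.floor_eq_iff (le_trans (by positivity) hy.1)]
    exact ⟨hy.1, by simpa using hy.2⟩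
  simp [this]

lemma gs_int (n : ℕ) (hn : 0 < n) :
    ∫ x in Set.Ioi (0 : ℝ), gs n x = (∑ j ∈ Finset.range (n + 1), qt n j) / √n := by
  have hsp : 0 < √(n : ℝ) := Real.sqrt_pos.2 (by exact_mod_cast hn)
  have h1 := integral_comp_mul_right_Ioi (fun y : ℝ => qt n ⌊y⌋₊) 0 hsp
  have h0 : (∫ x in Set.Ioi (0 : ℝ), gs n x) = ∫ x in Set.Ioi (0 : ℝ), qt n ⌊x * √n⌋₊ := rfl
  rw [h0, h1, zero_mul, smul_eq_mul, inv_mul_eq_div]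
  congr 1
  have h2 : ∫ y in Set.Ioi (0 : ℝ), qt n ⌊y⌋₊ = ∫ y in Set.Ioc (0 : ℝ) ((n + 1 : ℕ) : ℝ), qt n ⌊y⌋₊ := by
    refine setIntegral_eq_of_subset_of_forall_sdiff_eq_zero measurableSet_Ioi
      (fun x hx => hx.1) ?_
    rintro x ⟨hx1, hx2⟩
    refine qt_zero _ _ ?_
    have hx3 : ((n + 1 : ℕ) : ℝ) < x := by
      by_contra h
      exact hx2 ⟨hx1, not_lt.1 h⟩
    have : n + 1 ≤ ⌊x⌋₊ := Nat.le_floor hx3.le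
    omega
  rw [h2, ← intervalIntegral.integral_of_le (by positivity)]
  have hae : ∀ k : ℕ, ∀ᵐ y ∂(volume : Measure ℝ), y ∈ Set.uIoc (k : ℝ) ((k + 1 : ℕ) : ℝ) →
      qt n k = qt n ⌊y⌋₊ := by
    intro k
    have : ∀ᵐ y ∂(volume : Measure ℝ), y ≠ ((k + 1 : ℕ) : ℝ) := by
      simp [ae_iff]
    filter_upwards [this] with y hy hy2
    rw [Set.uIoc_of_le (by push_cast; linarith)] at hy2
    exact (unit_int (qt n) k ⟨hy2.1.le, lt_of_le_of_ne hy2.2 hy⟩).symm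
  have hint : ∀ k < n + 1, IntervalIntegrable (fun y : ℝ => qt n ⌊y⌋₊) volume ((k : ℕ) : ℝ)
      ((k + 1 : ℕ) : ℝ) := by
    intro k _
    have hc : IntervalIntegrable (fun _ : ℝ => qt n k) volume ((k : ℕ) : ℝ) ((k + 1 : ℕ) : ℝ) :=
      intervalIntegrable_const
    refine hc.congr_ae ?_
    exact (ae_restrict_iff' measurableSet_uIoc).2 (hae k)
  have h3 := intervalIntegral.sum_integral_adjacent_intervals (a := fun k : ℕ => (k : ℝ)) hint
  rw [Nat.cast_zero] at h3
  rw [← h3]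
  refine Finset.sum_congr rfl fun k _ => ?_
  rw [← intervalIntegral.integral_congr_ae (hae k)]
  simp

lemma coeff_U_pos (n : ℕ) (hn : 0 < n) : 0 < PowerSeries.coeff n U := by
  rw [coeff_U]; positivity

lemma U2_lim : Tendsto (fun n : ℕ => PowerSeries.coeff n (U ^ 2) / (PowerSeries.coeff n U * √n))
    atTop (𝓝 √(π / 2)) := by
  refine gs_int_lim.congr' ?_
  filter_upwards [eventually_gt_atTop 0] with n hn
  rw [gs_int n hn, ← U2_ratio n hn, div_div]

/-- limiting constants: `kap b` belongs to `U ^ (b+1)` -/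
noncomputable def kap : ℕ → ℝ
  | 0 => 1
  | 1 => √(π / 2)
  | (b + 2) => kap b / ((b : ℝ) + 1)

lemma inv_sqrt_lim : Tendsto (fun n : ℕ => (√(n : ℝ))⁻¹) atTop (𝓝 0) :=
  tendsto_inv_atTop_zero.comp (tendsto_sqrt_atTop.comp tendsto_natCast_atTop_atTop)

lemma Ub_lim : ∀ b : ℕ, Tendsto (fun n : ℕ => PowerSeries.coeff n (U ^ (b + 1)) /
    (PowerSeries.coeff n U * √n ^ b)) atTop (𝓝 (kap b))
  | 0 => by
    refine Tendsto.congr' ?_ (tendsto_const_nhds (x := (1 : ℝ)))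
    filter_upwards [eventually_gt_atTop 0] with n hn
    have := (coeff_U_pos n hn).ne'
    simp [this]
  | 1 => by
    have := U2_lim
    simp only [kap, pow_one]
    exact this
  | (b + 2) => by
    have h1 := (Ub_lim b).div_const ((b : ℝ) + 1)
    have h2 := (Ub_lim (b + 1)).mul inv_sqrt_lim
    have h3 := h1.add h2
    rw [mul_zero, add_zero] at h3
    refine h3.congr' ?_
    filter_upwards [eventually_gt_atTop 0] with n hn
    have h := coeff_U_step (b + 1) n (by omega)
    have e : b + 2 + 1 = b + 1 + 2 := by ring
    rw [e, h]
    have hU := (coeff_U_pos n hn).ne'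
    have hsp : 0 < √(n : ℝ) := Real.sqrt_pos.2 (by exact_mod_cast hn)
    have hsq : (n : ℝ) = √(n : ℝ) ^ 2 := (Real.sq_sqrt (by positivity)).symm
    have hb : (b : ℝ) + 1 ≠ 0 := by positivity
    generalize PowerSeries.coeff n U = u at *
    generalize PowerSeries.coeff n (U ^ (b + 1)) = x at *
    generalize PowerSeries.coeff n (U ^ (b + 1 + 1)) = y at *
    generalize √(n : ℝ) = s at *
    rw [hsq]
    push_cast
    field_simp
    try ring

lemma Ub_zero (a b : ℕ) (h : b < a) : Tendsto (fun n : ℕ => PowerSeries.coeff n (U ^ b) /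
    (PowerSeries.coeff n U * √n ^ (a - 1))) atTop (𝓝 0) := by
  cases b with
  | zero =>
    refine Tendsto.congr' ?_ (tendsto_const_nhds (x := (0 : ℝ)))
    filter_upwards [eventually_gt_atTop 0] with n hn
    simp [PowerSeries.coeff_one, hn.ne']
  | succ b =>
    have h2 := (Ub_lim b).mul (inv_sqrt_lim.pow (a - 1 - b))
    have h0 : a - 1 - b ≠ 0 := by omega
    rw [zero_pow h0, mul_zero] at h2
    refine h2.congr' ?_
    filter_upwards [eventually_gt_atTop 0] with n hn
    have e : a - 1 = b + (a - 1 - b) := by omega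
    have e2 : √(n : ℝ) ^ (a - 1) = √(n : ℝ) ^ b * √(n : ℝ) ^ (a - 1 - b) := by
      rw [← pow_add, ← e]
    rw [e2, inv_pow, ← mul_assoc, ← div_eq_mul_inv, div_div]

lemma Pd_lim (d : ℕ) (l : ℝ) (f : PowerSeries ℝ) (h : Pd (d + 1) l f) :
    Tendsto (fun n : ℕ => PowerSeries.coeff n f / (PowerSeries.coeff n U * √n ^ d)) atTop
      (𝓝 (l * kap d)) := by
  obtain ⟨p, hp, hl, rfl⟩ := h
  have e : ∀ n, PowerSeries.coeff n (Polynomial.aeval U p) / (PowerSeries.coeff n U * √n ^ d) =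
      (∑ i ∈ Finset.range (d + 1), p.coeff i * (PowerSeries.coeff n (U ^ i) /
    (PowerSeries.coeff n U * √n ^ (d + 1 - 1)))) + l * (PowerSeries.coeff n (U ^ (d + 1)) /
    (PowerSeries.coeff n U * √n ^ d)) := by
    intro n
    rw [Polynomial.aeval_eq_sum_range' (n := d + 1 + 1) (by omega), Finset.sum_range_succ, hl,
      map_add, map_sum, add_div, Finset.sum_div]
    simp [mul_div_assoc]
  simp only [e]
  have h1 : Tendsto (fun n : ℕ => ∑ i ∈ Finset.range (d + 1), p.coeff i * (PowerSeries.coeff n (U ^ i) /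
    (PowerSeries.coeff n U * √n ^ (d + 1 - 1)))) atTop (𝓝 (∑ i ∈ Finset.range (d + 1), p.coeff i * 0)) := by
    refine tendsto_finsetSum _ fun i hi => ?_
    exact (Ub_zero (d + 1) i (Finset.mem_range.1 hi)).const_mul _
  have := h1.add ((Ub_lim d).const_mul l)
  simpa using this

/-- raw moments -/
noncomputable def rm (k n : ℕ) : ℝ := S k n / S 0 n

lemma coeff_T (n : ℕ) (hn : 0 < n) : (n : ℝ) * PowerSeries.coeff n (F 0) = PowerSeries.coeff n U := by
  have := congrArg (PowerSeries.coeff n) D_T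
  rw [coeff_D] at this
  simpa [PowerSeries.coeff_one, hn.ne', T] using this

lemma S_pos (n : ℕ) (hn : 0 < n) : 0 < S 0 n := by
  have h1 := coeff_T n hn
  have h2 := coeff_U_pos n hn
  rw [← h1, F, coeff_egf] at h2
  have hn' : (0 : ℝ) < n := by exact_mod_cast hn
  have h3 := (pos_iff_pos_of_mul_pos h2).1 hn'
  have : (0 : ℝ) < n.factorial := by positivity
  by_contra h
  exact absurd h3 (not_lt.2 (div_nonpos_of_nonpos_of_nonneg (not_lt.1 h) this.le))

lemma rm_lim (j : ℕ) (hj : j ≤ 4) : Tendsto (fun n : ℕ => rm (j + 1) n / √n ^ (3 * (j + 1))) atTop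
    (𝓝 (lc j * kap (3 * j + 1))) := by
  refine (Pd_lim _ _ _ (F_Pd j hj)).congr' ?_
  filter_upwards [eventually_gt_atTop 0] with n hn
  have hS := S_pos n hn
  have h1 := coeff_T n hn
  rw [← h1]
  simp only [F, coeff_egf, rm]
  have hsp : 0 < √(n : ℝ) := Real.sqrt_pos.2 (by exact_mod_cast hn)
  have hsq : (n : ℝ) = √(n : ℝ) ^ 2 := (Real.sq_sqrt (by positivity)).symm
  have hf : (n.factorial : ℝ) ≠ 0 := by positivity
  generalize √(n : ℝ) = s at *
  rw [hsq]
  field_simp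
  try ring

end TH

end

section
namespace TH
open Filter Topology Real MeasureTheory

lemma sum_eq (k n : ℕ) : ∑ p ∈ RootedLabeledTrees n, (rlTotalHeight n p : ℝ) ^ k = S k n := by
  unfold S
  have h : RootedLabeledTrees n = rt (Fin n) := by
    ext p
    rw [mem_rt]
    simp [RootedLabeledTrees]
  rw [h]
  rfl

lemma card_eq (n : ℕ) : ((RootedLabeledTrees n).card : ℝ) = S 0 n := by
  rw [← sum_eq]; simp

lemma mu_eq (n : ℕ) : rlMu n = rm 1 n := by
  unfold rlMu rm
  have h := sum_eq 1 n
  simp only [pow_one] at h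
  rw [card_eq, h]

lemma m2_eq (n : ℕ) (hn : 0 < n) : rlCentralMoment 2 n = rm 2 n - rm 1 n ^ 2 := by
  have hS := (S_pos n hn).ne'
  unfold rlCentralMoment
  rw [card_eq, mu_eq]
  have h : ∀ x μ : ℝ, (x - μ) ^ 2 = x ^ 2 - 2 * μ * x ^ 1 + μ ^ 2 * x ^ 0 := by
    intros; ring
  simp only [h, Finset.sum_add_distrib, Finset.sum_sub_distrib, ← Finset.mul_sum, sum_eq]
  unfold rm
  field_simp
  ring

lemma m5_eq (n : ℕ) (hn : 0 < n) : rlCentralMoment 5 n = rm 5 n - 5 * rm 4 n * rm 1 n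
    + 10 * rm 3 n * rm 1 n ^ 2 - 10 * rm 2 n * rm 1 n ^ 3 + 4 * rm 1 n ^ 5 := by
  have hS := (S_pos n hn).ne'
  unfold rlCentralMoment
  rw [card_eq, mu_eq]
  have h : ∀ x μ : ℝ, (x - μ) ^ 5 = x ^ 5 - 5 * μ * x ^ 4 + 10 * μ ^ 2 * x ^ 3
    - 10 * μ ^ 3 * x ^ 2 + 5 * μ ^ 4 * x ^ 1 - μ ^ 5 * x ^ 0 := by
    intros; ring
  simp only [h, Finset.sum_add_distrib, Finset.sum_sub_distrib, ← Finset.mul_sum, sum_eq]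
  unfold rm
  field_simp
  ring

lemma m2_lim : Tendsto (fun n : ℕ => rlCentralMoment 2 n / √n ^ 6) atTop
    (𝓝 ((10 - 3 * π) / 6)) := by
  have h1 := rm_lim 0 (by omega)
  have h2 := rm_lim 1 (by omega)
  have h := h2.sub (h1.pow 2)
  have hs : √(π / 2) ^ 2 = π / 2 := Real.sq_sqrt (by positivity)
  have e : lc 1 * kap (3 * 1 + 1) - (lc 0 * kap (3 * 0 + 1)) ^ 2 = (10 - 3 * π) / 6 := by
    simp only [lc, kap]
    rw [mul_pow, hs]
    norm_num
    ring
  rw [e] at h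
  refine h.congr' ?_
  filter_upwards [eventually_gt_atTop 0] with n hn
  rw [m2_eq n hn]
  have hsp : 0 < √(n : ℝ) := Real.sqrt_pos.2 (by exact_mod_cast hn)
  norm_num
  field_simp

lemma m5_lim : Tendsto (fun n : ℕ => rlCentralMoment 5 n / √n ^ 15) atTop
    (𝓝 (√(π / 2) * (π ^ 2 + 25 / 24 * π - 105845 / 8064))) := by
  have h1 := rm_lim 0 (by omega)
  have h2 := rm_lim 1 (by omega)
  have h3 := rm_lim 2 (by omega)
  have h4 := rm_lim 3 (by omega)
  have h5 := rm_lim 4 (by omega)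
  have h := (((h5.sub ((h4.const_mul 5).mul h1)).add ((h3.const_mul 10).mul (h1.pow 2))).sub
    ((h2.const_mul 10).mul (h1.pow 3))).add ((h1.pow 5).const_mul 4)
  have hs : √(π / 2) ^ 2 = π / 2 := Real.sq_sqrt (by positivity)
  have e0 : lc 0 * kap (3 * 0 + 1) = √(π / 2) := by simp only [lc, kap]; ring
  have e1 : lc 1 * kap (3 * 1 + 1) = 5 / 3 := by simp only [lc, kap]; norm_num
  have e2 : lc 2 * kap (3 * 2 + 1) = 15 / 8 * √(π / 2) := by
    simp only [lc, kap]; push_cast; ring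
  have e3 : lc 3 * kap (3 * 3 + 1) = 221 / 63 := by simp only [lc, kap]; norm_num
  have e4 : lc 4 * kap (3 * 4 + 1) = 565 / 128 * √(π / 2) := by
    simp only [lc, kap]; push_cast; ring
  rw [e0, e1, e2, e3, e4] at h
  have hp : π = 2 * √(π / 2) ^ 2 := by rw [hs]; ring
  have e : √(π / 2) * (π ^ 2 + 25 / 24 * π - 105845 / 8064) =
      565 / 128 * √(π / 2) - 5 * (221 / 63) * √(π / 2) + 10 * (15 / 8 * √(π / 2)) * √(π / 2) ^ 2
      - 10 * (5 / 3) * √(π / 2) ^ 3 + 4 * √(π / 2) ^ 5 := by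
    generalize √(π / 2) = s at *
    rw [hp]
    ring
  rw [e]
  refine h.congr' ?_
  filter_upwards [eventually_gt_atTop 0] with n hn
  rw [m5_eq n hn]
  have hsp : 0 < √(n : ℝ) := Real.sqrt_pos.2 (by exact_mod_cast hn)
  norm_num
  field_simp

lemma pow_half (x : ℝ) (hx : 0 ≤ x) : (x ^ 2) ^ (((5 : ℕ) : ℝ) / 2) = x ^ 5 := by
  rw [← Real.rpow_natCast x 2, ← Real.rpow_mul hx]
  norm_num

lemma const_eq (p : ℝ) (hp : 0 < p) (h : 0 < 10 - 3 * p) :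
    √(p / 2) * (p ^ 2 + 25 / 24 * p - 105845 / 8064) / ((10 - 3 * p) / 6) ^ (((5 : ℕ) : ℝ) / 2) =
    (36 * p ^ 2 + (75 / 2) * p - 105845 / 224) * √3 * √(p / (10 - 3 * p)) / (10 - 3 * p) ^ 2 := by
  set d := 10 - 3 * p
  have hd : (d / 6) = √(d / 6) ^ 2 := (Real.sq_sqrt (by positivity)).symm
  rw [hd, pow_half _ (Real.sqrt_nonneg _)]
  have h5 : √(d / 6) ^ 5 = d ^ 2 / 36 * √(d / 6) := by
    have : √(d / 6) ^ 5 = (√(d / 6) ^ 2) ^ 2 * √(d / 6) := by ring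
    rw [this, ← hd]; ring
  have h6 : √(p / 2) = √3 * √(p / d) * √(d / 6) := by
    rw [← Real.sqrt_mul (by norm_num), ← Real.sqrt_mul (by positivity)]
    congr 1
    field_simp
    ring
  have h7 : 0 < √(d / 6) := Real.sqrt_pos.2 (by positivity)
  rw [h5, h6]
  field_simp
  ring

theorem main : Tendsto (fun n : ℕ => rlAlpha 5 n) atTop
      (nhds ((36 * π ^ 2 + (75 / 2) * π - 105845 / 224) * Real.sqrt 3 * Real.sqrt (π / (10 - 3 * π)) / (10 - 3 * π) ^ 2)) := by
  have hd : 0 < 10 - 3 * π := by have := Real.pi_lt_d2; linarith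
  rw [← const_eq π Real.pi_pos hd]
  have h2 := m2_lim.rpow_const (p := ((5 : ℕ) : ℝ) / 2) (Or.inl (by positivity))
  have h := m5_lim.div h2 (by positivity)
  refine h.congr' ?_
  filter_upwards [eventually_gt_atTop 0] with n hn
  have hsp : 0 < √(n : ℝ) := Real.sqrt_pos.2 (by exact_mod_cast hn)
  unfold rlAlpha
  have hm2 : 0 ≤ rlCentralMoment 2 n := by
    unfold rlCentralMoment
    exact div_nonneg (Finset.sum_nonneg fun p _ => sq_nonneg _) (by positivity)
  have e : √(n : ℝ) ^ 6 = (√(n : ℝ) ^ 3) ^ 2 := by ring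
  rw [Pi.div_apply, Real.div_rpow hm2 (by positivity), e, pow_half _ (by positivity), ← pow_mul]
  exact div_div_div_cancel_right₀ (by positivity) _ _

end TH

end

open Filter Real

/-- The `5`-th scaled moment of the total height on rooted labeled trees on `n`
vertices converges, as `n → ∞`, to the stated constant. -/
theorem totalheight_stmt16 :
    Tendsto (fun n : ℕ => rlAlpha 5 n) atTop
      (nhds ((36 * π ^ 2 + (75 / 2) * π - 105845 / 224) * Real.sqrt 3 * Real.sqrt (π / (10 - 3 * π)) / (10 - 3 * π) ^ 2)) := by
  exact TH.main
end

section
/- For n ≥ 1, let X_n be the random variable 'total height' (sum over all vertices of the graph distance to the root) on the set of rooted labeled trees on n vertices, equipped with the uniform distribution. Let μ(n) = E[X_n], m_i(n) = E[(X_n − μ(n))^i], and α_i(n) = m_i(n)/m_2(n)^{i/2}. Then lim_{n→∞} α_6(n) = (15/16016)·(−144144π³ − 720720π² + 3013725π + 2120320)/(10 − 3π)³ ≈ 27.685525695770609…. -/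
set_option autoImplicit false

section TreeCount
variable {α : Type*} [Fintype α] [DecidableEq α]

/-- graph of a parent function -/
def parentGraph (f : α → α) : SimpleGraph α := SimpleGraph.fromRel (fun a b => f a = b)

/-- `f` is a parent function towards `r` with level function `h` -/
def IsPar (r : α) (h : α → ℕ) (f : α → α) : Prop :=
  f r = r ∧ ∀ v, v ≠ r → h (f v) + 1 = h v

theorem parentGraph_walk {r : α} {h : α → ℕ} {f : α → α} (hr : ∀ v, h v = 0 ↔ v = r)
    (hf : IsPar r h f) : ∀ k v, h v = k → ∃ p : (parentGraph f).Walk v r, p.length = k := by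
  intro k
  induction k with
  | zero =>
    intro v hv
    obtain rfl := (hr v).1 hv
    exact ⟨SimpleGraph.Walk.nil, rfl⟩
  | succ k ih =>
    intro v hv
    have hne : v ≠ r := by
      intro e; have := (hr v).2 e; omega
    have h1 := hf.2 v hne
    obtain ⟨p, hp⟩ := ih (f v) (by omega)
    have hadj : (parentGraph f).Adj v (f v) := by
      rw [parentGraph, SimpleGraph.fromRel_adj]
      refine ⟨?_, Or.inl rfl⟩
      intro e; rw [← e] at h1; omega
    exact ⟨SimpleGraph.Walk.cons hadj p, by simp [hp]⟩

theorem parentGraph_lip {r : α} {h : α → ℕ} {f : α → α}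
    (hf : IsPar r h f) {a b : α} (hab : (parentGraph f).Adj a b) : h a ≤ h b + 1 := by
  rw [parentGraph, SimpleGraph.fromRel_adj] at hab
  obtain ⟨hne, e | e⟩ := hab
  · have har : a ≠ r := by
      rintro rfl; exact hne (hf.1.symm.trans e)
    have := hf.2 a har
    rw [e] at this; omega
  · have har : b ≠ r := by
      rintro rfl; exact hne (e.symm.trans hf.1)
    have := hf.2 b har
    rw [e] at this; omega

theorem parentGraph_dist {r : α} {h : α → ℕ} {f : α → α} (hr : ∀ v, h v = 0 ↔ v = r)
    (hf : IsPar r h f) (v : α) : (parentGraph f).dist v r = h v := by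
  obtain ⟨p, hp⟩ := parentGraph_walk hr hf (h v) v rfl
  apply le_antisymm
  · rw [← hp]; exact SimpleGraph.dist_le p
  · obtain ⟨q, hq⟩ := p.reachable.exists_walk_length_eq_dist
    rw [← hq]
    have key : ∀ (a b : α) (q : (parentGraph f).Walk a b), h a ≤ h b + q.length := by
      intro a b q
      induction q with
      | nil => simp
      | cons hadj q ih =>
        have := parentGraph_lip hf hadj
        simp only [SimpleGraph.Walk.length_cons]; omega
    have := key v r q
    have h0 := (hr r).2 rfl
    omega

theorem parentGraph_isTree {r : α} {h : α → ℕ} {f : α → α} (hr : ∀ v, h v = 0 ↔ v = r)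
    (hf : IsPar r h f) : (parentGraph f).IsTree := by
  classical
  have hconn : (parentGraph f).Connected := by
    have : Nonempty α := ⟨r⟩
    refine SimpleGraph.Connected.mk ?_
    intro a b
    obtain ⟨p, -⟩ := parentGraph_walk hr hf (h a) a rfl
    obtain ⟨q, -⟩ := parentGraph_walk hr hf (h b) b rfl
    exact p.reachable.trans q.reachable.symm
  rw [SimpleGraph.isTree_iff_connected_and_card]
  refine ⟨hconn, le_antisymm ?_ hconn.card_vert_le_card_edgeSet_add_one⟩
  rw [Nat.card_eq_fintype_card, Nat.card_eq_fintype_card, ← SimpleGraph.edgeFinset_card]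
  have hsub : (parentGraph f).edgeFinset ⊆ (Finset.univ.erase r).image (fun v => s(v, f v)) := by
    intro e
    refine Sym2.ind (fun a b => ?_) e
    rw [SimpleGraph.mem_edgeFinset, SimpleGraph.mem_edgeSet, parentGraph, SimpleGraph.fromRel_adj]
    rintro ⟨hne, e | e⟩
    · rw [Finset.mem_image]
      refine ⟨a, ?_, by rw [e]⟩
      simp only [Finset.mem_erase, Finset.mem_univ, and_true]
      rintro rfl; exact hne (hf.1.symm.trans e)
    · rw [Finset.mem_image]
      refine ⟨b, ?_, by rw [e, Sym2.eq_swap]⟩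
      simp only [Finset.mem_erase, Finset.mem_univ, and_true]
      rintro rfl; exact hne (e.symm.trans hf.1)
  have h1 := Finset.card_le_card hsub
  have h2 := Finset.card_image_le (s := Finset.univ.erase r) (f := fun v => s(v, f v))
  rw [Finset.card_erase_of_mem (Finset.mem_univ r), Finset.card_univ] at h2
  have : 0 < Fintype.card α := Fintype.card_pos_iff.2 ⟨r⟩
  omega

open Classical in
theorem card_trees_of_levels (r : α) (h : α → ℕ) (hr : ∀ v, h v = 0 ↔ v = r) :
    (Finset.univ.filter (fun T : SimpleGraph α => T.IsTree ∧ ∀ v, T.dist v r = h v)).card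
      = ∏ v ∈ Finset.univ.erase r, (Finset.univ.filter (fun w => h w + 1 = h v)).card := by
  have e1 : ∏ v ∈ Finset.univ.erase r, (Finset.univ.filter (fun w => h w + 1 = h v)).card
      = (Fintype.piFinset (fun v => if v = r then {r} else
          Finset.univ.filter (fun w => h w + 1 = h v))).card := by
    rw [Fintype.card_piFinset, ← Finset.mul_prod_erase Finset.univ _ (Finset.mem_univ r)]
    simp only [if_true, Finset.card_singleton, one_mul]
    refine Finset.prod_congr rfl ?_
    intro v hv
    rw [if_neg (Finset.ne_of_mem_erase hv)]
  rw [e1]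
  have hmem : ∀ f : α → α, f ∈ (Fintype.piFinset (fun v => if v = r then {r} else
          Finset.univ.filter (fun w => h w + 1 = h v))) ↔ IsPar r h f := by
    intro f
    rw [Fintype.mem_piFinset]
    constructor
    · intro H
      refine ⟨by simpa using H r, ?_⟩
      intro v hv
      simpa [hv] using H v
    · rintro ⟨H1, H2⟩ v
      by_cases hv : v = r
      · subst hv; simp [H1]
      · simp [hv, H2 v hv]
  symm
  refine Finset.card_bij (fun f _ => parentGraph f) ?_ ?_ ?_
  · intro f hf
    rw [hmem] at hf
    simp only [Finset.mem_filter, Finset.mem_univ, true_and]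
    exact ⟨parentGraph_isTree hr hf, parentGraph_dist hr hf⟩
  · intro f hf g hg hfg
    rw [hmem] at hf hg
    funext v
    by_cases hv : v = r
    · rw [hv, hf.1, hg.1]
    · have h1 := hf.2 v hv
      have hadj : (parentGraph f).Adj v (f v) := by
        rw [parentGraph, SimpleGraph.fromRel_adj]
        refine ⟨?_, Or.inl rfl⟩
        intro e; rw [← e] at h1; omega
      rw [hfg, parentGraph, SimpleGraph.fromRel_adj] at hadj
      obtain ⟨hne, e | e⟩ := hadj
      · exact e.symm
      · exfalso
        have hfr : f v ≠ r := by
          intro e2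
          rw [e2, hg.1] at e
          exact hv e.symm
        have := hg.2 (f v) hfr
        rw [e] at this
        omega
  · intro T hT
    simp only [Finset.mem_filter, Finset.mem_univ, true_and] at hT
    obtain ⟨hT, hd⟩ := hT
    have hex : ∀ v, v ≠ r → ∃ w, T.Adj v w ∧ h w + 1 = h v := by
      intro v hv
      obtain ⟨p, hp⟩ := hT.connected.exists_walk_length_eq_dist v r
      cases p with
      | nil => exact absurd rfl hv
      | cons hadj q =>
        rename_i w
        refine ⟨w, hadj, ?_⟩
        rw [hd, SimpleGraph.Walk.length_cons] at hp
        have h1 := SimpleGraph.dist_le q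
        rw [hd] at h1
        have h2 := hT.connected.dist_triangle (u := v) (v := w) (w := r)
        rw [hd, hd, SimpleGraph.dist_eq_one_iff_adj.2 hadj] at h2
        omega
    choose g hg using hex
    let f : α → α := fun v => if hv : v = r then r else g v hv
    have hf : IsPar r h f := by
      refine ⟨by simp [f], ?_⟩
      intro v hv
      simp only [f, dif_neg hv]
      exact (hg v hv).2
    refine ⟨f, (hmem f).2 hf, ?_⟩
    have hle : parentGraph f ≤ T := by
      intro a b hab
      rw [parentGraph, SimpleGraph.fromRel_adj] at hab
      obtain ⟨hne, e | e⟩ := hab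
      · have har : a ≠ r := by
          rintro rfl; exact hne (hf.1.symm.trans e)
        have := (hg a har).1
        simp only [f, dif_neg har] at e
        rwa [e] at this
      · have har : b ≠ r := by
          rintro rfl; exact hne (e.symm.trans hf.1)
        have := (hg b har).1
        simp only [f, dif_neg har] at e
        rw [e] at this
        exact this.symm
    exact le_antisymm hle ((SimpleGraph.isTree_iff_minimal_connected.1 hT).2
      (parentGraph_isTree hr hf).connected hle)

end TreeCount


set_option autoImplicit false

section Levels
variable {R : Type*} [CommRing R]

/-- level functions supported on `V`, with values in `[1,N]` there -/
def levelFns {α : Type*} [Fintype α] [DecidableEq α] (N : ℕ) (V : Finset α) : Finset (α → ℕ) :=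
  Fintype.piFinset (fun v => if v ∈ V then Finset.Icc 1 N else {0})

theorem mem_levelFns {α : Type*} [Fintype α] [DecidableEq α] {N : ℕ} {V : Finset α} {h : α → ℕ} :
    h ∈ levelFns N V ↔ (∀ v ∈ V, 1 ≤ h v ∧ h v ≤ N) ∧ (∀ v, v ∉ V → h v = 0) := by
  rw [levelFns, Fintype.mem_piFinset]
  constructor
  · intro H
    refine ⟨fun v hv => by simpa [hv] using H v, fun v hv => by simpa [hv] using H v⟩
  · rintro ⟨H1, H2⟩ v
    by_cases hv : v ∈ V
    · simp [hv, H1 v hv]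
    · simp [hv, H2 v hv]

/-- weight of a level function -/
def levelWt {α : Type*} [DecidableEq α] (V : Finset α) (k : ℕ) (h : α → ℕ) : ℕ :=
  ∏ v ∈ V, (if h v = 1 then k else (V.filter (fun w => h w + 1 = h v)).card)

def levelSum {α : Type*} [Fintype α] [DecidableEq α] (Y : R) (N : ℕ) (V : Finset α) (k : ℕ) : R :=
  ∑ h ∈ levelFns N V, (levelWt V k h : R) * Y ^ (∑ v, h v)

theorem levelSum_succ {α : Type*} [Fintype α] [DecidableEq α] (Y : R) (N : ℕ) (V : Finset α)
    (k : ℕ) : levelSum Y (N + 1) V k =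
      Y ^ V.card * ∑ M ∈ V.powerset, (k : R) ^ M.card * levelSum Y N (V \ M) M.card := by
  simp only [levelSum, Finset.mul_sum]
  rw [Finset.sum_sigma']
  refine Finset.sum_bij' (fun h _ => (⟨V.filter (fun v => h v = 1), fun v => h v - 1⟩ :
      Sigma (fun _ : Finset α => α → ℕ)))
    (fun p _ => fun v => if v ∈ V then p.2 v + 1 else 0) ?_ ?_ ?_ ?_ ?_
  · intro h hh
    rw [mem_levelFns] at hh
    obtain ⟨h1, h2⟩ := hh
    rw [Finset.mem_sigma, Finset.mem_powerset, mem_levelFns]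
    refine ⟨Finset.filter_subset _ _, ?_, ?_⟩
    · intro v hv
      simp only [Finset.mem_sdiff, Finset.mem_filter, not_and] at hv
      have := h1 v hv.1
      have := hv.2 hv.1
      dsimp only
      omega
    · intro v hv
      simp only [Finset.mem_sdiff, Finset.mem_filter, not_and] at hv
      by_cases hvV : v ∈ V
      · by_contra hne
        apply hv hvV
        intro _ e
        apply hne
        dsimp only; omega
      · have := h2 v hvV
        dsimp only; omega
  · rintro ⟨M, h'⟩ hp
    rw [Finset.mem_sigma, Finset.mem_powerset, mem_levelFns] at hp
    obtain ⟨hM, h1, h2⟩ := hp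
    rw [mem_levelFns]
    dsimp only at *
    refine ⟨?_, ?_⟩
    · intro v hv
      rw [if_pos hv]
      by_cases hvM : v ∈ M
      · have := h2 v (by simp [hvM]); omega
      · have := h1 v (by simp [hv, hvM]); omega
    · intro v hv
      rw [if_neg hv]
  · intro h hh
    rw [mem_levelFns] at hh
    obtain ⟨h1, h2⟩ := hh
    funext v
    dsimp only
    by_cases hv : v ∈ V
    · have := h1 v hv
      rw [if_pos hv]; omega
    · rw [if_neg hv, h2 v hv]
  · rintro ⟨M, h'⟩ hp
    rw [Finset.mem_sigma, Finset.mem_powerset, mem_levelFns] at hp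
    obtain ⟨hM, h1, h2⟩ := hp
    dsimp only at *
    have e1 : V.filter (fun v => (if v ∈ V then h' v + 1 else 0) = 1) = M := by
      ext v
      simp only [Finset.mem_filter]
      constructor
      · rintro ⟨hv, e⟩
        by_contra hvM
        have := h1 v (by simp [hv, hvM])
        rw [if_pos hv] at e; omega
      · intro hv
        refine ⟨hM hv, ?_⟩
        rw [if_pos (hM hv), h2 v (by simp [hv])]
    have e2 : (fun v => (if v ∈ V then h' v + 1 else 0) - 1) = h' := by
      funext v
      by_cases hv : v ∈ V
      · simp [hv]
      · rw [if_neg hv, h2 v (by simp [hv])]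
    rw [e1, e2]
  · intro h hh
    rw [mem_levelFns] at hh
    obtain ⟨h1, h2⟩ := hh
    dsimp only
    have es : ∑ v, h v = V.card + ∑ v, (h v - 1) := by
      have : V.card = ∑ v, (if v ∈ V then 1 else 0) := by simp
      rw [this, ← Finset.sum_add_distrib]
      refine Finset.sum_congr rfl fun v _ => ?_
      by_cases hv : v ∈ V
      · have := h1 v hv
        rw [if_pos hv]; omega
      · rw [if_neg hv, h2 v hv]
    have ew : levelWt V k h = k ^ (V.filter (fun v => h v = 1)).card *
        levelWt (V \ V.filter (fun v => h v = 1)) (V.filter (fun v => h v = 1)).card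
          (fun v => h v - 1) := by
      rw [levelWt, levelWt, ← Finset.prod_sdiff (Finset.filter_subset (fun v => h v = 1) V), mul_comm]
      congr 1
      · rw [← Finset.prod_const]
        refine Finset.prod_congr rfl fun v hv => ?_
        rw [if_pos (Finset.mem_filter.1 hv).2]
      · refine Finset.prod_congr rfl fun v hv => ?_
        simp only [Finset.mem_sdiff, Finset.mem_filter, not_and] at hv
        have hv1 := hv.2 hv.1
        have hv2 := h1 v hv.1
        rw [if_neg hv1]
        by_cases hv3 : h v = 2
        · rw [if_pos (by omega)]
          congr 1
          ext w
          simp only [Finset.mem_filter]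
          refine and_congr_right fun _ => ?_
          omega
        · rw [if_neg (by omega)]
          congr 1
          ext w
          simp only [Finset.mem_filter, Finset.mem_sdiff, not_and]
          constructor
          · rintro ⟨hw, e⟩
            refine ⟨⟨hw, fun _ => by omega⟩, by omega⟩
          · rintro ⟨⟨hw, hw2⟩, e⟩
            have := hw2 hw
            have := h1 w hw
            exact ⟨hw, by omega⟩
    rw [es, ew, pow_add]
    push_cast
    ring

/-- forest numbers: `n` non-root vertices, `k` roots, height at most `N` -/
def fW (Y : R) : ℕ → ℕ → ℕ → R
  | 0, n, _ => if n = 0 then 1 else 0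
  | N + 1, n, k => Y ^ n * ∑ m ∈ Finset.range (n + 1),
      (n.choose m : R) * ((k : R) ^ m * fW Y N (n - m) m)

theorem levelSum_eq {α : Type*} [Fintype α] [DecidableEq α] (Y : R) (N : ℕ) :
    ∀ (V : Finset α) (k : ℕ), levelSum Y N V k = fW Y N V.card k := by
  induction N with
  | zero =>
    intro V k
    rw [fW]
    split_ifs with hV
    · rw [Finset.card_eq_zero] at hV
      subst hV
      have : levelFns 0 (∅ : Finset α) = {fun _ => 0} := by
        ext h
        rw [mem_levelFns]
        simp [funext_iff]
      simp [levelSum, this, levelWt]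
    · have : levelFns 0 V = ∅ := by
        ext h
        rw [mem_levelFns]
        simp only [Finset.notMem_empty, iff_false]
        rintro ⟨h1, -⟩
        obtain ⟨v, hv⟩ := Finset.card_pos.1 (Nat.pos_of_ne_zero hV)
        have := h1 v hv
        omega
      simp [levelSum, this]
  | succ N ih =>
    intro V k
    rw [levelSum_succ, fW]
    congr 1
    have := Finset.sum_powerset_apply_card (x := V)
      (fun m => (k : R) ^ m * fW Y N (V.card - m) m)
    simp only [nsmul_eq_mul] at this
    rw [← this]
    refine Finset.sum_congr rfl fun M hM => ?_
    rw [ih, Finset.card_sdiff_of_subset (Finset.mem_powerset.1 hM)]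

open Classical in
theorem sum_trees_root {α : Type*} [Fintype α] [DecidableEq α] (Y : R) (r : α) :
    ∑ T ∈ (Finset.univ.filter (fun T : SimpleGraph α => T.IsTree)), Y ^ (∑ v, T.dist v r)
      = fW Y (Fintype.card α) (Fintype.card α - 1) 1 := by
  have hc : (Finset.univ.erase r).card = Fintype.card α - 1 := by
    rw [Finset.card_erase_of_mem (Finset.mem_univ r), Finset.card_univ]
  rw [← hc, ← levelSum_eq, levelSum]
  rw [← Finset.sum_fiberwise_of_maps_to (g := fun T v => T.dist v r)
    (t := levelFns (Fintype.card α) (Finset.univ.erase r))]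
  · refine Finset.sum_congr rfl fun h hh => ?_
    rw [mem_levelFns] at hh
    obtain ⟨h1, h2⟩ := hh
    have hr : ∀ v, h v = 0 ↔ v = r := by
      intro v
      constructor
      · intro e
        by_contra hne
        have := h1 v (by simp [hne])
        omega
      · rintro rfl
        exact h2 _ (by simp)
    have hcard := card_trees_of_levels r h hr
    rw [Finset.sum_congr rfl (g := fun _ => Y ^ ∑ v, h v)]
    · rw [Finset.sum_const, nsmul_eq_mul]
      congr 2
      rw [Finset.filter_filter]
      simp only [funext_iff]
      rw [hcard, levelWt]
      refine Finset.prod_congr rfl fun v hv => ?_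
      split_ifs with e
      · rw [Finset.card_eq_one]
        refine ⟨r, ?_⟩
        ext w
        simp [e, hr]
      · congr 1
        ext w
        simp only [Finset.mem_filter, Finset.mem_univ, true_and, Finset.mem_erase, and_true]
        constructor
        · intro e2
          refine ⟨?_, e2⟩
          intro e3
          have := (hr w).2 e3
          omega
        · exact fun e2 => e2.2
    · intro T hT
      rw [Finset.mem_filter] at hT
      congr 1
      exact Finset.sum_congr rfl fun v _ => congrFun hT.2 v
  · intro T hT
    rw [Finset.mem_filter] at hT
    rw [mem_levelFns]
    have hconn := hT.2.connected
    refine ⟨?_, ?_⟩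
    · intro v hv
      have hv := Finset.ne_of_mem_erase hv
      refine ⟨hconn.pos_dist_of_ne hv, ?_⟩
      obtain ⟨p, hp, hl⟩ := hconn.exists_path_of_dist v r
      rw [← hl]
      exact hp.length_lt.le
    · intro v hv
      have : v = r := by simpa using hv
      rw [this]; exact SimpleGraph.dist_self

end Levels

theorem sum_rooted {R : Type*} [CommRing R] (Y : R) (n : ℕ) :
    ∑ p ∈ RootedLabeledTrees n, Y ^ (rlTotalHeight n p) = n * fW Y n (n - 1) 1 := by
  classical
  have e : RootedLabeledTrees n = (Finset.univ.filter
      (fun T : SimpleGraph (Fin n) => T.IsTree)) ×ˢ (Finset.univ : Finset (Fin n)) := by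
    ext p
    simp [RootedLabeledTrees]
  rw [e, Finset.sum_product_right]
  simp only [rlTotalHeight]
  have : ∀ r : Fin n, ∑ T ∈ (Finset.univ.filter (fun T : SimpleGraph (Fin n) => T.IsTree)),
      Y ^ (∑ v, T.dist v r) = fW Y n (n - 1) 1 := by
    intro r
    have := sum_trees_root Y r
    rw [Fintype.card_fin] at this
    rw [← this]
  rw [Finset.sum_congr rfl fun r _ => this r]
  simp


set_option linter.unusedSectionVars false
set_option autoImplicit false

section GF
open PowerSeries
variable {R : Type*} [CommRing R] [Algebra ℚ R]

noncomputable def gInner (y : R) (p : R⟦X⟧) : R⟦X⟧ := X * (C y * rescale y p)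

noncomputable def fP (y : R) : ℕ → R⟦X⟧
  | 0 => 1
  | N + 1 => (exp R).subst (gInner y (fP y N))

theorem gInner_hasSubst (y : R) (p : R⟦X⟧) : HasSubst (gInner y p) :=
  HasSubst.of_constantCoeff_zero' (by simp [gInner])

theorem coeff_gInner_pow (y : R) (p : R⟦X⟧) (n m : ℕ) :
    coeff n (gInner y p ^ m) = if m ≤ n then y ^ n * coeff (n - m) (p ^ m) else 0 := by
  have : gInner y p ^ m = X ^ m * (C (y ^ m) * rescale y (p ^ m)) := by
    rw [gInner, mul_pow, mul_pow, map_pow, map_pow]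
  rw [this, coeff_X_pow_mul']
  split_ifs with h
  · rw [coeff_C_mul, coeff_rescale, ← mul_assoc, ← pow_add]
    congr 2; omega
  · rfl

theorem coeff_gInner_zero (y : R) (p : R⟦X⟧) : coeff 0 (gInner y p) = 0 := by
  simp [gInner]

theorem coeff_gInner_succ (y : R) (p : R⟦X⟧) (n : ℕ) :
    coeff (n + 1) (gInner y p) = y ^ (n + 1) * coeff n p := by
  have := coeff_gInner_pow y p (n + 1) 1
  simpa using this

theorem coeff_fP (y : R) : ∀ N n k : ℕ, (n.factorial : R) * coeff n (fP y N ^ k) = fW y N n k := by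
  intro N
  induction N with
  | zero =>
    intro n k
    rw [fP, one_pow, coeff_one, fW]
    split_ifs with h
    · subst h; simp
    · simp
  | succ N ih =>
    intro n k
    rw [fP, fW, ← subst_pow (gInner_hasSubst y _), exp_pow_eq_rescale_exp,
      coeff_subst' (gInner_hasSubst y _)]
    rw [finsum_eq_sum_of_support_subset (s := Finset.range (n + 1))]
    · rw [Finset.mul_sum, Finset.mul_sum]
      refine Finset.sum_congr rfl fun m hm => ?_
      have hm : m ≤ n := by simpa [Nat.lt_succ_iff] using hm
      rw [coeff_gInner_pow, if_pos hm, coeff_rescale, coeff_exp, smul_eq_mul, ← ih]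
      have h1 : (n.factorial : R) = n.choose m * m.factorial * (n - m).factorial := by
        rw [← Nat.choose_mul_factorial_mul_factorial hm]; push_cast; ring
      have h2 : (m.factorial : R) * algebraMap ℚ R (1 / (m.factorial : ℚ)) = 1 := by
        rw [← map_natCast (algebraMap ℚ R), ← map_mul, mul_one_div_cancel, map_one]
        exact_mod_cast m.factorial_ne_zero
      rw [h1]
      linear_combination (n.choose m * (n - m).factorial * (k : R) ^ m * y ^ n *
        coeff (n - m) (fP y N ^ m)) * h2
    · intro m hm
      rw [Function.mem_support] at hm
      rw [Finset.mem_coe, Finset.mem_range]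
      by_contra hlt
      apply hm
      rw [coeff_gInner_pow, if_neg (by omega), smul_zero]

theorem fW_zero_right (y : R) (N n : ℕ) : fW y N n 0 = if n = 0 then 1 else 0 := by
  rw [← coeff_fP, pow_zero, coeff_one]
  split_ifs with h
  · subst h; simp
  · simp

theorem fW_stab (y : R) : ∀ N n k, n ≤ N → fW y (N + 1) n k = fW y N n k := by
  intro N
  induction N with
  | zero =>
    intro n k hn
    obtain rfl : n = 0 := by omega
    simp [fW]
  | succ N ih =>
    intro n k hn
    rw [fW, fW]
    congr 1
    refine Finset.sum_congr rfl fun m hm => ?_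
    rcases Nat.eq_zero_or_pos m with h | h
    · subst h; rw [fW_zero_right, fW_zero_right]
    · rw [ih _ _ (by omega)]

theorem fW_stab' (y : R) (N n k : ℕ) (h : n ≤ N) : fW y N n k = fW y n n k := by
  induction N, h using Nat.le_induction with
  | base => rfl
  | succ N hN ih => rw [fW_stab y N n k hN, ih]

theorem fact_cancel (n : ℕ) {a b : R} (h : (n.factorial : R) * a = n.factorial * b) : a = b := by
  have h2 : algebraMap ℚ R (1 / (n.factorial : ℚ)) * (n.factorial : R) = 1 := by
    rw [← map_natCast (algebraMap ℚ R), ← map_mul, one_div_mul_cancel, map_one]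
    exact_mod_cast n.factorial_ne_zero
  linear_combination algebraMap ℚ R (1 / (n.factorial : ℚ)) * h + (b - a) * h2

/-- the limiting series -/
noncomputable def fH (y : R) : R⟦X⟧ := PowerSeries.mk fun n => coeff n (fP y n)

theorem coeff_fP_stab (y : R) (N n : ℕ) (h : n ≤ N) : coeff n (fP y N) = coeff n (fH y) := by
  rw [fH, coeff_mk]
  apply fact_cancel n
  have h1 := coeff_fP y N n 1
  have h2 := coeff_fP y n n 1
  rw [pow_one] at h1 h2
  rw [h1, h2, fW_stab' y N n 1 h]

theorem coeff_fH_pow (y : R) (n k : ℕ) : (n.factorial : R) * coeff n (fH y ^ k) = fW y n n k := by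
  rw [← coeff_fP]
  congr 1
  have h1 : (X : R⟦X⟧) ^ (n + 1) ∣ fH y - fP y n := by
    rw [X_pow_dvd_iff]
    intro m hm
    rw [map_sub, coeff_fP_stab y n m (by omega), sub_self]
  have h2 := h1.trans (sub_dvd_pow_sub_pow (fH y) (fP y n) k)
  rw [X_pow_dvd_iff] at h2
  have := h2 n (by omega)
  rwa [map_sub, sub_eq_zero] at this

theorem coeff_fH_rec (y : R) (n : ℕ) :
    (n : R) * coeff n (fH y) = ∑ p ∈ Finset.HasAntidiagonal.antidiagonal n,
      coeff p.1 (fH y) * ((p.2 : R) * (y ^ p.2 * coeff p.2 (X * fH y))) := by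
  have hd : X * derivative R (fP y (n + 1)) =
      fP y (n + 1) * (X * derivative R (gInner y (fP y n))) := by
    rw [fP, derivative_subst (gInner_hasSubst y _), derivative_exp]
    ring
  have hX : ∀ (p : R⟦X⟧) (j : ℕ), coeff j (X * derivative R p) = j * coeff j p := by
    intro p j
    cases j with
    | zero => simp
    | succ j => rw [coeff_succ_X_mul, coeff_derivative]; push_cast; ring
  have := congrArg (coeff n) hd
  rw [hX, coeff_fP_stab _ _ _ (by omega), coeff_mul] at this
  rw [this]
  refine Finset.sum_congr rfl fun p hp => ?_
  rw [Finset.HasAntidiagonal.mem_antidiagonal] at hp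
  rw [hX, coeff_fP_stab _ _ _ (by omega)]
  congr 2
  rcases p with ⟨i, j⟩
  cases j with
  | zero => simp [coeff_gInner_zero]
  | succ j =>
    dsimp only at *
    rw [coeff_gInner_succ, coeff_succ_X_mul, coeff_fP_stab _ _ _ (by omega)]

end GF

section Moments
open PowerSeries

/-- `y = e^u` -/
noncomputable def yExp : ℝ⟦X⟧ := exp ℝ

noncomputable def fF (n : ℕ) : ℝ⟦X⟧ := coeff n (X * fH yExp)

theorem fF_zero : fF 0 = 0 := by simp [fF]

theorem fF_one : fF 1 = 1 := by
  rw [fF, show (1:ℕ) = 0 + 1 from rfl, coeff_succ_X_mul, fH]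
  simp [fP]

theorem sum_rooted_exp (n : ℕ) :
    ∑ p ∈ RootedLabeledTrees n, yExp ^ (rlTotalHeight n p) = (n.factorial : ℝ⟦X⟧) * fF n := by
  rw [sum_rooted]
  cases n with
  | zero => simp [fF_zero]
  | succ n =>
    rw [fF, coeff_succ_X_mul, Nat.factorial_succ]
    have := coeff_fH_pow yExp n 1
    rw [pow_one] at this
    push_cast
    rw [mul_assoc, this, fW_stab' _ _ _ _ (Nat.le_succ n)]

theorem coeff_yExp_pow (k j : ℕ) : coeff k (yExp ^ j) = (j : ℝ) ^ k / k.factorial := by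
  rw [yExp, exp_pow_eq_rescale_exp, coeff_rescale, coeff_exp]
  simp [div_eq_mul_inv]

theorem sum_rooted_pow (n k : ℕ) :
    ∑ p ∈ RootedLabeledTrees n, (rlTotalHeight n p : ℝ) ^ k
      = k.factorial * (n.factorial * coeff k (fF n)) := by
  have h := congrArg (coeff k) (sum_rooted_exp n)
  rw [map_sum] at h
  simp only [coeff_yExp_pow] at h
  rw [← Finset.sum_div] at h
  have e : coeff k ((n.factorial : ℝ⟦X⟧) * fF n) = n.factorial * coeff k (fF n) := by
    rw [← nsmul_eq_mul, map_nsmul, nsmul_eq_mul]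
  rw [e] at h
  have : (k.factorial : ℝ) ≠ 0 := by exact_mod_cast k.factorial_ne_zero
  field_simp at h
  linarith

theorem fF_rec (n : ℕ) : ((n : ℝ⟦X⟧)) * fF n = fF n + ∑ p ∈ Finset.HasAntidiagonal.antidiagonal n,
      fF p.1 * ((p.2 : ℝ⟦X⟧) * (yExp ^ p.2 * fF p.2)) := by
  cases n with
  | zero => simp [fF_zero]
  | succ n =>
    rw [Finset.Nat.antidiagonal_succ]
    simp only [Finset.sum_cons, fF_zero, zero_mul, zero_add, Finset.sum_map,
      Function.Embedding.prodMap, Function.Embedding.coeFn_mk, Prod.map,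
      Function.Embedding.refl_apply]
    have e : ∀ j, fF (j + 1) = coeff j (fH yExp) := fun j => by rw [fF, coeff_succ_X_mul]
    have := coeff_fH_rec yExp n
    simp only [Nat.succ_eq_add_one, e]
    push_cast
    rw [add_mul, this]
    simp only [fF]
    ring

noncomputable def fPhi (k : ℕ) : ℝ⟦X⟧ := PowerSeries.mk fun n => coeff k (fF n)

/-- Euler operator -/
noncomputable def eD : Derivation ℝ ℝ⟦X⟧ ℝ⟦X⟧ := (X : ℝ⟦X⟧) • derivative ℝ

theorem coeff_eD (p : ℝ⟦X⟧) (j : ℕ) : coeff j (eD p) = j * coeff j p := by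
  have : eD p = X * derivative ℝ p := rfl
  rw [this]
  cases j with
  | zero => simp
  | succ j => rw [coeff_succ_X_mul, coeff_derivative]; push_cast; ring

theorem coeff_eD_iter (p : ℝ⟦X⟧) (l j : ℕ) : coeff j (eD^[l] p) = (j : ℝ) ^ l * coeff j p := by
  induction l with
  | zero => simp
  | succ l ih => rw [Function.iterate_succ_apply', coeff_eD, ih]; ring

theorem fPhi_eq (k : ℕ) : eD (fPhi k) = fPhi k + ∑ a ∈ Finset.HasAntidiagonal.antidiagonal k,
    fPhi a.1 * ∑ b ∈ Finset.HasAntidiagonal.antidiagonal a.2,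
      ((1 / (b.2.factorial : ℝ)) • eD^[b.2 + 1] (fPhi b.1)) := by
  ext n
  have h := congrArg (coeff k) (fF_rec n)
  rw [map_add, map_sum] at h
  have e : coeff k ((n : ℝ⟦X⟧) * fF n) = n * coeff k (fF n) := by
    rw [← nsmul_eq_mul, map_nsmul, nsmul_eq_mul]
  rw [e] at h
  rw [coeff_eD, map_add, map_sum]
  simp only [fPhi, coeff_mk]
  rw [h]
  congr 1
  conv_lhs => enter [2, p]; rw [coeff_mul]
  conv_rhs => enter [2, a]; rw [coeff_mul]
  simp only [map_sum, coeff_mk]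
  rw [Finset.sum_comm]
  refine Finset.sum_congr rfl fun a _ => Finset.sum_congr rfl fun p _ => ?_
  congr 1
  have e2 : coeff a.2 ((p.2 : ℝ⟦X⟧) * (yExp ^ p.2 * fF p.2))
      = p.2 * coeff a.2 (fF p.2 * yExp ^ p.2) := by
    rw [← nsmul_eq_mul, map_nsmul, nsmul_eq_mul, mul_comm (fF p.2)]
  rw [e2, coeff_mul, Finset.mul_sum]
  refine Finset.sum_congr rfl fun b _ => ?_
  rw [coeff_yExp_pow, coeff_smul, coeff_eD_iter, coeff_mk, smul_eq_mul]
  ring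

end Moments


set_option autoImplicit false

section Cayley
open PowerSeries

theorem fW_one_succ : ∀ N n k : ℕ, n + 1 ≤ N →
    fW (1 : ℝ) N (n + 1) k = k * ((n : ℝ) + 1 + k) ^ n := by
  intro N
  induction N with
  | zero => intro n k h; omega
  | succ N ih =>
    intro n k h
    rw [fW, one_pow, one_mul, Finset.sum_range_succ']
    rw [Nat.sub_zero, fW_zero_right, if_neg (Nat.succ_ne_zero n), mul_zero, mul_zero, add_zero]
    have key : ∀ m ∈ Finset.range (n + 1),
        ((n + 1).choose (m + 1) : ℝ) * ((k : ℝ) ^ (m + 1) * fW (1 : ℝ) N (n + 1 - (m + 1)) (m + 1))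
        = k * ((k : ℝ) ^ m * ((n : ℝ) + 1) ^ (n - m) * (n.choose m)) := by
      intro m hm
      have hm : m ≤ n := by simpa [Nat.lt_succ_iff] using hm
      have h1 : ((n : ℝ) + 1) * fW (1 : ℝ) N (n + 1 - (m + 1)) (m + 1)
          = (m + 1) * ((n : ℝ) + 1) ^ (n - m) := by
        rw [Nat.add_sub_add_right]
        rcases Nat.eq_zero_or_pos (n - m) with h0 | h0
        · have : n = m := by omega
          subst this
          have e : fW (1 : ℝ) N 0 (n + 1) = 1 := by
            cases N with
            | zero => simp [fW]
            | succ N =>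
              rw [← coeff_fP]
              rw [fW_stab' (1 : ℝ) _ _ _ (Nat.zero_le _) |> fun h => (coeff_fP (1 : ℝ) _ _ _).trans h]
              simp [fW]
          simp [e]
        · obtain ⟨j, hj⟩ : ∃ j, n - m = j + 1 := ⟨n - m - 1, by omega⟩
          rw [hj, ih j (m + 1) (by omega)]
          have : (n : ℝ) = j + 1 + m := by
            have : n = j + 1 + m := by omega
            rw [this]; push_cast; ring
          rw [this]; push_cast; ring
      have h2 : ((n + 1).choose (m + 1) : ℝ) * (m + 1) = (n + 1) * n.choose m := by
        have := Nat.add_one_mul_choose_eq n m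
        exact_mod_cast this.symm
      have hn : (n : ℝ) + 1 ≠ 0 := by positivity
      apply mul_left_cancel₀ hn
      linear_combination ((n + 1).choose (m + 1) : ℝ) * (k : ℝ) ^ (m + 1) * h1
        + (k : ℝ) ^ (m + 1) * ((n : ℝ) + 1) ^ (n - m) * h2
    rw [Finset.sum_congr rfl key, ← Finset.mul_sum, ← add_pow]
    ring

theorem map_fW {R R' : Type*} [CommRing R] [CommRing R'] (f : R →+* R') (y : R) :
    ∀ N n k, f (fW y N n k) = fW (f y) N n k := by
  intro N
  induction N with
  | zero =>
    intro n k
    rw [fW, fW]; split_ifs <;> simp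
  | succ N ih =>
    intro n k
    rw [fW, fW]
    simp [ih]

noncomputable def fT : ℝ⟦X⟧ := fPhi 0
noncomputable def hH : ℝ⟦X⟧ := fH (1 : ℝ)
noncomputable def fS : ℝ⟦X⟧ := (1 - fT)⁻¹

theorem fT_eq : fT = X * hH := by
  ext n
  rw [fT, fPhi, coeff_mk, coeff_zero_eq_constantCoeff_apply]
  cases n with
  | zero => simp [fF_zero]
  | succ n =>
    rw [fF, coeff_succ_X_mul, coeff_succ_X_mul]
    apply fact_cancel n
    have h1 := coeff_fH_pow yExp n 1
    have h2 := coeff_fH_pow (1 : ℝ) n 1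
    rw [pow_one] at h1 h2
    rw [hH, h2]
    have h3 := congrArg (constantCoeff (R := ℝ)) h1
    rw [map_fW, map_mul, map_natCast] at h3
    rw [h3, yExp, constantCoeff_exp]

theorem coeff_hH_zero : coeff 0 hH = 1 := by
  have h2 := coeff_fH_pow (1 : ℝ) 0 1
  simpa [fW, hH] using h2

theorem fS_mul : fS * (1 - fT) = 1 := by
  rw [fS]
  refine PowerSeries.inv_mul_cancel _ ?_
  simp [fT_eq]

theorem fS_T : fS * fT = fS - 1 := by
  linear_combination -fS_mul

theorem eD_T : eD fT = fS - 1 := by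
  have h := fPhi_eq 0
  simp only [Finset.Nat.antidiagonal_zero, Finset.sum_singleton, Nat.factorial_zero, Nat.cast_one,
    div_one, one_smul, zero_add, Function.iterate_one] at h
  change eD fT = fT + fT * eD fT at h
  have h2 := fS_T
  have h3 := fS_mul
  linear_combination fS * h - eD fT * h3 + h2

theorem eD_S : eD fS = fS ^ 3 - fS ^ 2 := by
  have h := congrArg eD fS_mul
  rw [Derivation.leibniz, map_sub, eD_T, Derivation.map_one_eq_zero] at h
  simp only [smul_eq_mul] at h
  linear_combination fS * h - eD fS * fS_mul

theorem eD_S_pow (m : ℕ) : eD (fS ^ m) = (m : ℝ⟦X⟧) * (fS ^ (m + 2) - fS ^ (m + 1)) := by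
  rw [Derivation.leibniz_pow, eD_S]
  cases m with
  | zero => simp
  | succ m => simp only [smul_eq_mul, nsmul_eq_mul, Nat.add_sub_cancel]; ring

theorem coeff_natCast_mul (a n : ℕ) (p : ℝ⟦X⟧) :
    coeff n ((a : ℝ⟦X⟧) * p) = a * coeff n p := by
  rw [← nsmul_eq_mul, map_nsmul, nsmul_eq_mul]

/-- coefficients of powers of `S` -/
noncomputable def sC (m n : ℕ) : ℝ := coeff n (fS ^ m)

theorem sC_rec (m n : ℕ) : (n : ℝ) * sC m n = m * (sC (m + 2) n - sC (m + 1) n) := by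
  have h := congrArg (coeff n) (eD_S_pow m)
  rw [coeff_eD, coeff_natCast_mul, map_sub] at h
  exact h

theorem eD_H : eD hH = hH * eD fT := by
  ext n
  rw [coeff_eD, hH, coeff_fH_rec, coeff_mul]
  refine Finset.sum_congr rfl fun p _ => ?_
  rw [coeff_eD, fT_eq, hH, one_pow, one_mul]

theorem coeff_H_S_succ (k n : ℕ) :
    (n.factorial : ℝ) * coeff n (hH ^ (k + 1) * fS) = ((n : ℝ) + (k + 1)) ^ n := by
  have h : eD (hH ^ (k + 1)) = ((k + 1 : ℕ) : ℝ⟦X⟧) * (hH ^ (k + 1) * fS - hH ^ (k + 1)) := by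
    rw [Derivation.leibniz_pow, eD_H, eD_T]
    simp only [smul_eq_mul, nsmul_eq_mul, Nat.add_sub_cancel]; ring
  have h2 := congrArg (coeff n) h
  rw [coeff_eD, coeff_natCast_mul, map_sub] at h2
  have h3 := coeff_fH_pow (1 : ℝ) n (k + 1)
  change (n.factorial : ℝ) * coeff n (hH ^ (k + 1)) = _ at h3
  have hk : ((k + 1 : ℕ) : ℝ) ≠ 0 := by positivity
  apply mul_left_cancel₀ hk
  have h4 : ((k + 1 : ℕ) : ℝ) * ((n.factorial : ℝ) * coeff n (hH ^ (k + 1) * fS))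
      = ((n : ℝ) + (k + 1 : ℕ)) * fW 1 n n (k + 1) := by
    rw [← h3]
    linear_combination -(n.factorial : ℝ) * h2
  rw [h4]
  cases n with
  | zero => simp [fW]
  | succ n =>
    rw [fW_one_succ _ _ _ le_rfl]
    push_cast
    ring

theorem sC_one (n : ℕ) : (n.factorial : ℝ) * sC 1 n = (n : ℝ) ^ n := by
  have h : fS = 1 + X * (hH ^ (0 + 1) * fS) := by
    have := fS_T
    rw [fT_eq] at this
    linear_combination -this
  rw [sC, pow_one, h, map_add]
  cases n with
  | zero => simp
  | succ n =>
    rw [coeff_succ_X_mul, coeff_one, if_neg (Nat.succ_ne_zero n), zero_add, Nat.factorial_succ]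
    have := coeff_H_S_succ 0 n
    push_cast at this ⊢
    rw [zero_add] at this
    rw [mul_assoc, this]
    ring

theorem coeff_H_S (k n : ℕ) :
    (n.factorial : ℝ) * coeff n (hH ^ k * fS) = ((n : ℝ) + k) ^ n := by
  cases k with
  | zero =>
    have := sC_one n
    rw [sC, pow_one] at this
    simp [this]
  | succ k => rw [coeff_H_S_succ]; push_cast; rfl

theorem sC_two (n : ℕ) : sC 2 n = ∑ j ∈ Finset.range (n + 1), (n : ℝ) ^ (n - j) / (n - j).factorial := by
  have h : ∀ J : ℕ, fS ^ 2 = ∑ j ∈ Finset.range J, fT ^ j * fS + fT ^ J * fS ^ 2 := by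
    intro J
    induction J with
    | zero => simp
    | succ J ih =>
      rw [Finset.sum_range_succ, pow_succ fT]
      have := fS_T
      linear_combination ih - fT ^ J * fS * this
  rw [sC, h (n + 1), map_add, map_sum]
  have h0 : coeff n (fT ^ (n + 1) * fS ^ 2) = 0 := by
    rw [fT_eq, mul_pow, mul_assoc, coeff_X_pow_mul', if_neg (by omega)]
  rw [h0, add_zero]
  refine Finset.sum_congr rfl fun j hj => ?_
  have hj : j ≤ n := by simpa [Nat.lt_succ_iff] using hj
  rw [fT_eq, mul_pow, mul_assoc, coeff_X_pow_mul', if_pos hj]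
  have h1 := coeff_H_S j (n - j)
  rw [Nat.cast_sub hj, sub_add_cancel] at h1
  rw [← h1]
  have : ((n - j).factorial : ℝ) ≠ 0 := by exact_mod_cast (n - j).factorial_ne_zero
  field_simp

theorem sC_two_div (n : ℕ) (hn : 1 ≤ n) :
    sC 2 n = sC 1 n * ∑ j ∈ Finset.range (n + 1), (n.choose j : ℝ) * j.factorial / (n : ℝ) ^ j := by
  rw [sC_two, Finset.mul_sum]
  refine Finset.sum_congr rfl fun j hj => ?_
  have hj : j ≤ n := by simpa [Nat.lt_succ_iff] using hj
  have h1 := sC_one n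
  have hf : (n.factorial : ℝ) ≠ 0 := by exact_mod_cast n.factorial_ne_zero
  have hf2 : ((n - j).factorial : ℝ) ≠ 0 := by exact_mod_cast (n - j).factorial_ne_zero
  have hn0 : (n : ℝ) ≠ 0 := by positivity
  have h2 : (n.factorial : ℝ) = n.choose j * j.factorial * (n - j).factorial := by
    rw [← Nat.choose_mul_factorial_mul_factorial hj]; push_cast; ring
  have h3 : (n : ℝ) ^ n = (n : ℝ) ^ (n - j) * (n : ℝ) ^ j := by
    rw [← pow_add]; congr 1; omega
  rw [div_eq_iff hf2]
  rw [eq_comm, mul_div_assoc', div_mul_eq_mul_div, div_eq_iff (by positivity), ← h3, ← h1, h2]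
  ring

theorem sC_one_pos (n : ℕ) (hn : 1 ≤ n) : 0 < sC 1 n := by
  have h1 := sC_one n
  have hf : (0 : ℝ) < n.factorial := by exact_mod_cast n.factorial_pos
  have hn0 : (0 : ℝ) < (n : ℝ) ^ n := by positivity
  rw [← h1] at hn0
  exact (mul_pos_iff_of_pos_left hf).1 hn0

theorem coeff_fF_zero (n : ℕ) : (n : ℝ) * coeff 0 (fF n) = if n = 0 then 0 else sC 1 n := by
  have h := congrArg (coeff n) eD_T
  rw [coeff_eD, map_sub, coeff_one] at h
  have e : coeff n fT = coeff 0 (fF n) := by rw [fT, fPhi, coeff_mk]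
  rw [e] at h
  rw [h, sC, pow_one]
  split_ifs with h0
  · subst h0; simp only [coeff_zero_eq_constantCoeff_apply]; simp [fS, fT_eq]
  · simp

end Cayley


set_option autoImplicit false

section Poly
open PowerSeries

/-- list polynomials over the rationals -/
def padd : List ℚ → List ℚ → List ℚ
  | [], q => q
  | a :: p, [] => a :: p
  | a :: p, b :: q => (a + b) :: padd p q

def pscale (c : ℚ) (l : List ℚ) : List ℚ := l.map (fun a => c * a)

def pmul : List ℚ → List ℚ → List ℚ
  | [], _ => []
  | a :: p, q => padd (pscale a q) (0 :: pmul p q)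

def pD : List ℚ → List ℚ
  | [] => []
  | _ :: l => padd (0 :: pD l) (0 :: 0 :: padd (pscale (-1) l) (0 :: l))

def psum : ℕ → (ℕ → List ℚ) → List ℚ
  | 0, _ => []
  | n + 1, f => padd (psum n f) (f n)

/-- the polynomials in `S` giving the moment series -/
def pk : ℕ → List ℚ
    | 1 => [1, -2, 1]
    | 2 => [0, 0, -2, 13/2, -7, 5/2]
    | 3 => [0, 0, 0, -8/3, 22, -389/6, 268/3, -353/6, 15]
    | 4 => [0, 0, 0, 0, -4, 257/4, -8797/24, 12463/12, -19645/12, 35171/24, -16771/24, 1105/8]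
    | 5 => [0, 0, 0, 0, 0, -32/5, 1771/10, -101477/60, 97241/12, -540967/24, 582083/15,
      -5048959/120, 28031, -125993/12, 1695]
    | 6 => [0, 0, 0, 0, 0, 0, -32/3, 4757/10, -842803/120, 18575267/360, -2672707/12,
      88386823/144, -810659653/720, 502122563/360, -207968197/180, 44218345/72, -9102133/48,
      414125/16]
    | _ => []

noncomputable def ev : List ℚ → ℝ⟦X⟧
  | [] => 0
  | a :: l => C (a : ℝ) + fS * ev l

theorem ev_padd : ∀ p q : List ℚ, ev (padd p q) = ev p + ev q
  | [], q => by simp [padd, ev]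
  | a :: p, [] => by simp [padd, ev]
  | a :: p, b :: q => by
    rw [padd, ev, ev, ev, ev_padd p q]
    push_cast
    rw [map_add]; ring

theorem ev_pscale (c : ℚ) : ∀ p : List ℚ, ev (pscale c p) = C (c : ℝ) * ev p
  | [] => by simp [pscale, ev]
  | a :: p => by
    have ih := ev_pscale c p
    rw [pscale] at ih ⊢
    rw [List.map_cons, ev, ev, ih]
    push_cast
    rw [map_mul]; ring

theorem ev_pmul : ∀ p q : List ℚ, ev (pmul p q) = ev p * ev q
  | [], q => by simp [pmul, ev]
  | a :: p, q => by
    rw [pmul, ev_padd, ev_pscale, ev, ev, ev_pmul p q]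
    simp only [Rat.cast_zero, map_zero]
    ring

theorem eD_C (c : ℝ) : eD (C c) = 0 := by
  ext n
  rw [coeff_eD, coeff_C]
  split_ifs with h
  · simp [h]
  · simp

theorem ev_pD : ∀ p : List ℚ, ev (pD p) = eD (ev p)
  | [] => by simp [pD, ev]
  | a :: p => by
    rw [pD, ev_padd, ev, ev, ev, ev_padd, ev_pscale, ev, ev, ev_pD p, map_add, eD_C,
      Derivation.leibniz, eD_S]
    simp only [Rat.cast_zero, map_zero, smul_eq_mul, Rat.cast_neg, Rat.cast_one, map_neg, map_one]
    ring

theorem ev_pD_iter (l : ℕ) (p : List ℚ) : ev (pD^[l] p) = eD^[l] (ev p) := by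
  induction l with
  | zero => rfl
  | succ l ih => rw [Function.iterate_succ_apply', Function.iterate_succ_apply', ev_pD, ih]

theorem ev_psum (n : ℕ) (f : ℕ → List ℚ) : ev (psum n f) = ∑ i ∈ Finset.range n, ev (f i) := by
  induction n with
  | zero => simp [psum, ev]
  | succ n ih => rw [psum, ev_padd, ih, Finset.sum_range_succ]

theorem ev_allzero : ∀ p : List ℚ, p.all (fun a => decide (a = 0)) = true → ev p = 0
  | [], _ => rfl
  | a :: p, h => by
    rw [List.all_cons, Bool.and_eq_true, decide_eq_true_eq] at h
    rw [ev, ev_allzero p h.2, h.1]; simp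

/-- polynomial of `S * Phi a` -/
def pq (a : ℕ) : List ℚ := if a = 0 then [-1, 1] else 0 :: pk a

/-- polynomial of `D^(l+1) (Phi b)` -/
def pd (b l : ℕ) : List ℚ := if b = 0 then pD^[l] [-1, 1] else pD^[l + 1] (pk b)

def pRhs (k : ℕ) : List ℚ :=
  psum (k + 1) fun a => pmul (pq a)
    (psum (k - a + 1) fun b => pscale (1 / ((k - a - b).factorial : ℚ)) (pd b (k - a - b)))

def pChk (k : ℕ) : List ℚ :=
  padd (0 :: pD (pk k)) (pscale (-1) (padd (0 :: pk k) (pRhs k)))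

def pc0 : List ℚ → ℚ
  | [] => 0
  | a :: l => a + pc0 l

def pc1 : List ℚ → ℚ
  | [] => 0
  | _ :: l => pc0 l + pc1 l

theorem pChk_ok : ∀ k : Fin 6, (pChk (k + 1)).all (fun a => decide (a = 0)) = true := by
  decide +kernel

theorem pc1_ok : ∀ k : Fin 6, pc1 (pk (k + 1)) = 0 := by
  decide +kernel

theorem fS_coeff_zero : coeff 0 fS = 1 := by
  have := sC_one 0
  simpa [sC] using this

theorem fS_coeff_one : coeff 1 fS = 1 := by
  have := sC_one 1
  simpa [sC] using this

theorem ev_coeff_zero : ∀ p : List ℚ, coeff 0 (ev p) = (pc0 p : ℝ)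
  | [] => by simp [ev, pc0]
  | a :: p => by
    have ih := ev_coeff_zero p
    have h := fS_coeff_zero
    rw [coeff_zero_eq_constantCoeff_apply] at ih h ⊢
    rw [ev, pc0, map_add, map_mul, ih, h]
    simp

theorem ev_coeff_one : ∀ p : List ℚ, coeff 1 (ev p) = (pc1 p : ℝ)
  | [] => by simp [ev, pc1]
  | a :: p => by
    rw [ev, pc1, map_add, coeff_mul, Finset.Nat.antidiagonal_succ]
    simp [-coeff_zero_eq_constantCoeff, ev_coeff_zero, ev_coeff_one p, fS_coeff_zero, fS_coeff_one,
      coeff_C]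
    ring

noncomputable def fPsi (k : ℕ) : ℝ⟦X⟧ := if k = 0 then fT else ev (pk k)

noncomputable def eRhs (φ : ℕ → ℝ⟦X⟧) (k : ℕ) : ℝ⟦X⟧ :=
  ∑ a ∈ Finset.range (k + 1), fS * φ a * ∑ b ∈ Finset.range (k - a + 1),
    ((1 / ((k - a - b).factorial : ℝ)) • eD^[k - a - b + 1] (φ b))

theorem fPhi_eRhs (k : ℕ) : fS * eD (fPhi k) = fS * fPhi k + eRhs fPhi k := by
  conv_lhs => rw [fPhi_eq]
  rw [mul_add, eRhs]
  congr 1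
  rw [Finset.Nat.sum_antidiagonal_eq_sum_range_succ_mk, Finset.mul_sum]
  refine Finset.sum_congr rfl fun a _ => ?_
  rw [Finset.Nat.sum_antidiagonal_eq_sum_range_succ_mk, mul_assoc]

theorem ev_pq (a : ℕ) : ev (pq a) = fS * fPsi a := by
  rw [pq, fPsi]
  split_ifs with h
  · rw [fS_T]; simp [ev]; ring
  · simp [ev]

theorem ev_pd (b l : ℕ) : ev (pd b l) = eD^[l + 1] (fPsi b) := by
  rw [pd, fPsi]
  split_ifs with h
  · rw [ev_pD_iter, Function.iterate_succ_apply, eD_T]; congr 1; simp [ev]; ring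
  · rw [ev_pD_iter]

theorem ev_pRhs (k : ℕ) : ev (pRhs k) = eRhs fPsi k := by
  rw [pRhs, eRhs, ev_psum]
  refine Finset.sum_congr rfl fun a _ => ?_
  rw [ev_pmul, ev_pq, ev_psum]
  congr 1
  refine Finset.sum_congr rfl fun b _ => ?_
  rw [ev_pscale, ev_pd, smul_eq_C_mul]
  push_cast
  rfl

theorem fPsi_eRhs (k : ℕ) (h0 : k ≠ 0) (hk : (pChk k).all (fun a => decide (a = 0)) = true) :
    fS * eD (fPsi k) = fS * fPsi k + eRhs fPsi k := by
  have h := ev_allzero _ hk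
  rw [pChk, ev_padd, ev_pscale, ev_padd, ev_pRhs, ev, ev, ev_pD] at h
  rw [fPsi, if_neg h0]
  simp only [Rat.cast_zero, map_zero, Rat.cast_neg, Rat.cast_one, map_neg, map_one] at h
  linear_combination h

theorem ode_unique (Δ : ℝ⟦X⟧) (h : eD Δ = fS ^ 2 * Δ) (h1 : coeff 1 Δ = 0) : Δ = 0 := by
  have h0 : coeff 0 (fS ^ 2) = 1 := by
    have := fS_coeff_zero
    rw [coeff_zero_eq_constantCoeff_apply] at this ⊢
    rw [map_pow, this, one_pow]
  ext n
  rw [map_zero]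
  induction n using Nat.strong_induction_on with
  | _ n ih =>
    by_cases hn : n = 1
    · rw [hn, h1]
    · have := congrArg (coeff n) h
      rw [coeff_eD, coeff_mul, Finset.Nat.sum_antidiagonal_eq_sum_range_succ_mk,
        Finset.sum_range_succ'] at this
      rw [Finset.sum_eq_zero] at this
      · simp only [Nat.sub_zero, h0] at this
        have h2 : ((n : ℝ) - 1) * coeff n Δ = 0 := by linear_combination this
        rcases mul_eq_zero.1 h2 with h3 | h3
        · exfalso; apply hn
          have : (n : ℝ) = 1 := by linarith
          exact_mod_cast this
        · exact h3
      · intro i hi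
        rw [Finset.mem_range] at hi
        dsimp only
        rw [ih (n - (i + 1)) (by omega), mul_zero]

noncomputable def eRest (φ : ℕ → ℝ⟦X⟧) (k : ℕ) : ℝ⟦X⟧ :=
  (∑ a ∈ Finset.range k, fS * φ (a + 1) * ∑ b ∈ Finset.range (k - a + 1),
    ((1 / ((k - a - b).factorial : ℝ)) • eD^[k - a - b + 1] (φ b))) +
  fS * φ 0 * ∑ b ∈ Finset.range (k + 1),
    ((1 / ((k + 1 - b).factorial : ℝ)) • eD^[k + 1 - b + 1] (φ b))

theorem eRhs_succ (φ : ℕ → ℝ⟦X⟧) (k : ℕ) :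
    eRhs φ (k + 1) = fS * φ (k + 1) * eD (φ 0) + fS * φ 0 * eD (φ (k + 1)) + eRest φ k := by
  rw [eRhs, Finset.sum_range_succ', Finset.sum_range_succ, eRest]
  simp only [Nat.add_sub_add_right, Nat.sub_self, Nat.sub_zero, zero_add, Finset.sum_range_one,
    Nat.factorial_zero, Nat.cast_one, div_one, one_smul, Function.iterate_one]
  rw [Finset.sum_range_succ _ (k + 1)]
  simp only [Nat.sub_self, Nat.factorial_zero, Nat.cast_one, div_one, one_smul, zero_add,
    Function.iterate_one]
  ring

theorem eRest_congr (φ ψ : ℕ → ℝ⟦X⟧) (k : ℕ) (h : ∀ j ≤ k, φ j = ψ j) :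
    eRest φ k = eRest ψ k := by
  rw [eRest, eRest]
  congr 1
  · refine Finset.sum_congr rfl fun a ha => ?_
    rw [Finset.mem_range] at ha
    rw [h (a + 1) (by omega)]
    congr 1
    refine Finset.sum_congr rfl fun b hb => ?_
    rw [Finset.mem_range] at hb
    rw [h b (by omega)]
  · rw [h 0 (by omega)]
    congr 1
    refine Finset.sum_congr rfl fun b hb => ?_
    rw [Finset.mem_range] at hb
    rw [h b (by omega)]

theorem fPhi_eq_fPsi : ∀ k, k ≤ 6 → fPhi k = fPsi k := by
  intro k
  induction k using Nat.strong_induction_on with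
  | _ k ih =>
    intro hk
    cases k with
    | zero => rfl
    | succ k =>
      have e1 := fPhi_eRhs (k + 1)
      have e2 := fPsi_eRhs (k + 1) (Nat.succ_ne_zero k) (pChk_ok ⟨k, by omega⟩)
      rw [eRhs_succ] at e1 e2
      rw [eRest_congr fPhi fPsi k (fun j hj => ih j (by omega) (by omega)),
        ih 0 (by omega) (by omega)] at e1
      have e0 : fPsi 0 = fT := rfl
      rw [e0, eD_T] at e1 e2
      have hST := fS_T
      rw [← sub_eq_zero]
      apply ode_unique
      · rw [map_sub]
        linear_combination e1 - e2 + (eD (fPhi (k + 1)) - eD (fPsi (k + 1))) * hST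
      · rw [map_sub, fPsi, if_neg (Nat.succ_ne_zero k), ev_coeff_one, fPhi, coeff_mk, fF_one,
          pc1_ok ⟨k, by omega⟩, coeff_one, if_neg (Nat.succ_ne_zero k)]
        simp

theorem ev_eq_sum : ∀ p : List ℚ, ev p = ∑ i ∈ Finset.range p.length,
    ((p.getD i 0 : ℚ) : ℝ) • fS ^ i
  | [] => by simp [ev]
  | a :: p => by
    rw [ev, List.length_cons, Finset.sum_range_succ', ev_eq_sum p, Finset.mul_sum, add_comm]
    congr 1
    · refine Finset.sum_congr rfl fun i _ => ?_
      rw [List.getD_cons_succ, mul_smul_comm, pow_succ']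
    · rw [List.getD_cons_zero, pow_zero, smul_eq_C_mul, mul_one]

theorem coeff_fF_eq (k n : ℕ) (h0 : k ≠ 0) (hk : k ≤ 6) : coeff k (fF n) =
    ∑ i ∈ Finset.range (pk k).length, (((pk k).getD i 0 : ℚ) : ℝ) * sC i n := by
  have h := congrArg (coeff n) (fPhi_eq_fPsi k hk)
  rw [fPhi, coeff_mk, fPsi, if_neg h0, ev_eq_sum, map_sum] at h
  rw [h]
  refine Finset.sum_congr rfl fun i _ => ?_
  rw [coeff_smul, smul_eq_mul, sC]

end Poly


section E2sec
open MeasureTheory Filter Topology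

lemma int_pow_exp (j : ℕ) (r : ℝ) (hr : 0 < r) :
    ∫ s in Set.Ioi (0:ℝ), s ^ j * Real.exp (-(r * s)) = j.factorial / r ^ (j+1) := by
  have h := Real.integral_rpow_mul_exp_neg_mul_Ioi (a := (j:ℝ)+1) (r := r) (by positivity) hr
  rw [Real.Gamma_nat_eq_factorial] at h
  have e : ((j:ℝ) + 1) = ((j+1 : ℕ) : ℝ) := by push_cast; ring
  have h2 : (1 / r) ^ ((j:ℝ)+1) * (j.factorial : ℝ) = j.factorial / r ^ (j+1) := by
    rw [e, Real.rpow_natCast, one_div, inv_pow]; field_simp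
  rw [h2] at h
  rw [← h]
  congr 1
  ext s
  simp [Real.rpow_natCast]

lemma int_pow_exp_integrable (j : ℕ) (r : ℝ) (hr : 0 < r) :
    IntegrableOn (fun s : ℝ => s ^ j * Real.exp (-(r * s))) (Set.Ioi 0) := by
  by_contra h
  have h1 := int_pow_exp j r hr
  rw [integral_undef h] at h1
  have : (0:ℝ) < j.factorial / r ^ (j+1) := by positivity
  linarith

noncomputable def gK (n : ℕ) (s : ℝ) : ℝ :=
  (1 + s / √(n:ℝ)) ^ n * Real.exp (-(√(n:ℝ) * s))

lemma int_gK (n : ℕ) (hn : 1 ≤ n) :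
    ∫ s in Set.Ioi (0:ℝ), gK n s =
      (∑ j ∈ Finset.range (n+1), (n.choose j : ℝ) * j.factorial / (n:ℝ)^j) / √(n:ℝ) := by
  have hr : 0 < √(n:ℝ) := Real.sqrt_pos.2 (by exact_mod_cast hn)
  have e : gK n = fun s => ∑ j ∈ Finset.range (n+1),
      ((n.choose j : ℝ) / √(n:ℝ) ^ j) * (s ^ j * Real.exp (-(√(n:ℝ) * s))) := by
    ext s
    rw [gK, add_comm, add_pow, Finset.sum_mul]
    refine Finset.sum_congr rfl fun j _ => ?_
    rw [div_pow]; simp; ring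
  rw [e, integral_finsetSum _ fun j _ => (int_pow_exp_integrable j _ hr).const_mul _]
  rw [Finset.sum_div]
  refine Finset.sum_congr rfl fun j _ => ?_
  rw [integral_const_mul, int_pow_exp j _ hr]
  have : (n:ℝ)^j = √(n:ℝ)^j * √(n:ℝ)^j := by
    rw [← mul_pow, Real.mul_self_sqrt (by positivity)]
  rw [this, pow_succ]
  field_simp

lemma gK_eq (n : ℕ) (hn : 1 ≤ n) (s : ℝ) (hs : 0 ≤ s) :
    gK n s = Real.exp (n * (Real.log (1 + s / √(n:ℝ)) - s / √(n:ℝ))) := by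
  have hr : 0 < √(n:ℝ) := Real.sqrt_pos.2 (by exact_mod_cast hn)
  have hp : 0 < 1 + s / √(n:ℝ) := by positivity
  rw [gK, mul_sub, Real.exp_sub, Real.exp_nat_mul, Real.exp_log hp, Real.exp_neg, div_eq_mul_inv]
  congr 3
  have := Real.mul_self_sqrt (show (0:ℝ) ≤ n by positivity)
  nth_rewrite 2 [← this]
  field_simp

lemma gK_bound (n : ℕ) (hn : 1 ≤ n) (s : ℝ) (hs : 0 ≤ s) :
    gK n s ≤ Real.exp 1 * Real.exp (-(1/2 * s)) := by
  have hr1 : 1 ≤ √(n:ℝ) := by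
    rw [Real.one_le_sqrt]; exact_mod_cast hn
  have hr : 0 < √(n:ℝ) := by linarith
  rw [gK_eq n hn s hs, ← Real.exp_add, Real.exp_le_exp]
  set r := √(n:ℝ) with hrdef
  have hrr : (n:ℝ) = r * r := (Real.mul_self_sqrt (by positivity)).symm
  rw [hrr]
  set y := s / r with hy
  have hsy : s = r * y := by rw [hy]; field_simp
  have hy0 : 0 ≤ y := by positivity
  obtain ⟨w, hw1, hw⟩ : ∃ w : ℝ, 1 ≤ w ∧ 1 + y = w ^ 2 :=
    ⟨√(1+y), by rw [Real.one_le_sqrt]; linarith, (Real.sq_sqrt (by positivity)).symm⟩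
  have hlog : Real.log (1 + y) ≤ 2 * (w - 1) := by
    rw [hw, Real.log_pow]
    have := Real.log_le_sub_one_of_pos (show 0 < w by linarith)
    push_cast; linarith
  have h1 : Real.log (1+y) - y ≤ - (w-1)^2 := by nlinarith
  have h2 : r * r * (Real.log (1+y) - y) ≤ r * r * (- (w-1)^2) :=
    mul_le_mul_of_nonneg_left h1 (by positivity)
  refine h2.trans ?_
  have hyw : y = w^2 - 1 := by linarith
  rw [hsy, hyw]
  -- r²(w-1)² - r(w-1)(w+1)/2 + 1 ≥ 0 with r ≥ 1
  set d := w - 1 with hd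
  have hd0 : 0 ≤ d := by linarith
  have : w = d + 1 := by linarith
  rw [this]
  nlinarith [sq_nonneg (r * d - 1), mul_nonneg (mul_nonneg hr.le (sub_nonneg.2 hr1)) (sq_nonneg d)]

lemma gK_tendsto (s : ℝ) (hs : 0 ≤ s) :
    Tendsto (fun n : ℕ => gK n s) atTop (𝓝 (Real.exp (-(1/2) * s^2))) := by
  have hsq : Tendsto (fun n : ℕ => √(n:ℝ)) atTop atTop :=
    Real.tendsto_sqrt_atTop.comp tendsto_natCast_atTop_atTop
  have key : Tendsto (fun n : ℕ => (n:ℝ) * (Real.log (1 + s / √(n:ℝ)) - s / √(n:ℝ))) atTop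
      (𝓝 (-(1/2) * s^2)) := by
    have hyb : ∀ᶠ n : ℕ in atTop, 2 * s + 1 ≤ √(n:ℝ) := hsq.eventually_ge_atTop _
    have hmain : ∀ᶠ n : ℕ in atTop, 
        |(n:ℝ) * (Real.log (1 + s / √(n:ℝ)) - s / √(n:ℝ)) + 1/2 * s^2| ≤ 2 * s^3/√(n:ℝ) := by
      filter_upwards [hyb] with n hn
      have hr : 0 < √(n:ℝ) := by linarith
      set r := √(n:ℝ) with hrdef
      have hrr : (n:ℝ) = r * r := (Real.mul_self_sqrt (by positivity)).symm
      rw [hrr]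
      have hy0 : 0 ≤ s / r := by positivity
      have hy2 : s / r ≤ 1/2 := by rw [div_le_iff₀ hr]; linarith
      have h := Real.abs_log_sub_add_sum_range_le (x := -(s/r)) (by rw [abs_neg, abs_of_nonneg hy0]; linarith) 2
      simp only [Finset.sum_range_succ, Finset.sum_range_zero, abs_neg, sub_neg_eq_add, abs_of_nonneg hy0] at h
      norm_num at h
      have h3 : (s/r)^3 / (1 - s/r) ≤ 2 * (s/r)^3 := by
        rw [div_le_iff₀ (by linarith)]
        have : 0 ≤ (s/r)^3 := by positivity
        nlinarith
      have h4 := mul_le_mul_of_nonneg_left (h.trans h3) (show 0 ≤ r*r by positivity)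
      rw [← abs_of_nonneg (show 0 ≤ r*r by positivity), ← abs_mul, abs_of_nonneg (show 0 ≤ r*r by positivity)] at h4
      have e1 : r * (s / r) = s := by field_simp
      have e2 : r * r * (-(s / r) + (s / r) ^ 2 / 2 + Real.log (1 + s / r))
          = r * r * (Real.log (1 + s / r) - s / r) + 1 / 2 * s ^ 2 := by
        linear_combination (1 / 2) * (r * (s / r) + s) * e1
      have e3 : r * r * (2 * (s / r) ^ 3) = 2 * s ^ 3 / r := by
        rw [eq_div_iff hr.ne']
        nth_rewrite 2 [← e1]
        ring
      rw [e2, e3] at h4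
      exact h4
    rw [tendsto_iff_dist_tendsto_zero]
    have hb2 : Tendsto (fun n : ℕ => 2 * s^3 / √(n:ℝ)) atTop (𝓝 0) := hsq.const_div_atTop _
    refine squeeze_zero' (Eventually.of_forall fun n => dist_nonneg) ?_ hb2
    filter_upwards [hmain] with n hn
    rw [Real.dist_eq]
    convert hn using 2
    ring
  refine ((Real.continuous_exp.tendsto _).comp key).congr' ?_
  filter_upwards [eventually_ge_atTop 1] with n hn
  exact (gK_eq n hn s hs).symm

lemma q_tendsto :
    Tendsto (fun n : ℕ => (sC 2 n / sC 1 n) / √(n:ℝ)) atTop (𝓝 (√(Real.pi / 2))) := by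
  have hlim : Tendsto (fun n : ℕ => ∫ s in Set.Ioi (0:ℝ), gK n s) atTop
      (𝓝 (∫ s in Set.Ioi (0:ℝ), Real.exp (-(1/2) * s^2))) := by
    refine tendsto_integral_filter_of_dominated_convergence
      (fun s => Real.exp 1 * Real.exp (-(1/2 * s))) ?_ ?_ ?_ ?_
    · refine Eventually.of_forall fun n => Continuous.aestronglyMeasurable ?_
      unfold gK; fun_prop
    · filter_upwards [eventually_ge_atTop 1] with n hn
      filter_upwards [ae_restrict_mem measurableSet_Ioi] with s hs
      have hs' : 0 ≤ s := le_of_lt hs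
      rw [Real.norm_of_nonneg]
      · exact gK_bound n hn s hs'
      · rw [gK_eq n hn s hs']; positivity
    · have := (int_pow_exp_integrable 0 (1/2) (by norm_num)).const_mul (Real.exp 1)
      simpa using this
    · filter_upwards [ae_restrict_mem measurableSet_Ioi] with s hs
      exact gK_tendsto s (le_of_lt hs)
  rw [integral_gaussian_Ioi] at hlim
  have e : √(Real.pi / (1/2)) / 2 = √(Real.pi/2) := by
    rw [div_eq_iff (by norm_num), Real.sqrt_eq_iff_eq_sq (by positivity) (by positivity), mul_pow, Real.sq_sqrt (by positivity)]
    ring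
  rw [e] at hlim
  refine hlim.congr' ?_
  filter_upwards [eventually_ge_atTop 1] with n hn
  rw [int_gK n hn, sC_two_div n hn, mul_div_cancel_left₀ _ (sC_one_pos n hn).ne']

end E2sec


section E3sec
open Filter Topology

noncomputable def kap : ℕ → ℝ
  | 0 => 1
  | 1 => √(Real.pi / 2)
  | (m + 2) => kap m / (m + 1)

noncomputable def rR (m n : ℕ) : ℝ := sC (m + 1) n / sC 1 n / √(n:ℝ) ^ m

lemma sqrt_nat_tendsto : Tendsto (fun n : ℕ => √(n:ℝ)) atTop atTop :=
  Real.tendsto_sqrt_atTop.comp tendsto_natCast_atTop_atTop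

lemma rR_rec (m n : ℕ) (hn : 1 ≤ n) : rR (m + 2) n = rR m n / (m + 1) + rR (m + 1) n / √(n:ℝ) := by
  have hr : 0 < √(n:ℝ) := Real.sqrt_pos.2 (by exact_mod_cast hn)
  have h1 := (sC_one_pos n hn).ne'
  have h := sC_rec (m + 1) n
  have hm : (m:ℝ) + 1 ≠ 0 := by positivity
  have hs : √(n:ℝ) ^ 2 = n := Real.sq_sqrt (by positivity)
  have h3 : sC (m + 3) n = √(n:ℝ) ^ 2 * sC (m + 1) n / (m + 1) + sC (m + 2) n := by
    rw [hs]; push_cast at h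
    rw [h]; field_simp; ring
  unfold rR
  rw [show m + 2 + 1 = m + 3 from rfl, show m + 1 + 1 = m + 2 from rfl, h3]
  field_simp
  ring

lemma rR_tendsto : ∀ m : ℕ, Tendsto (rR m) atTop (𝓝 (kap m)) ∧ Tendsto (rR (m + 1)) atTop (𝓝 (kap (m + 1))) := by
  intro m
  induction m with
  | zero =>
    constructor
    · refine (tendsto_const_nhds (x := (1:ℝ))).congr' ?_
      filter_upwards [eventually_ge_atTop 1] with n hn
      simp [rR, (sC_one_pos n hn).ne']
    · have := q_tendsto
      refine this.congr fun n => ?_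
      simp [rR]
  | succ m ih =>
    refine ⟨ih.2, ?_⟩
    have h := (ih.1.div_const ((m:ℝ) + 1)).add (ih.2.div_atTop sqrt_nat_tendsto)
    rw [add_zero] at h
    refine h.congr' ?_
    filter_upwards [eventually_ge_atTop 1] with n hn
    exact (rR_rec m n hn).symm

lemma sC_zero (n : ℕ) (hn : 1 ≤ n) : sC 0 n = 0 := by
  have : n ≠ 0 := by omega
  simp [sC, PowerSeries.coeff_one, this]

lemma poly_tendsto (N : ℕ) (p : ℕ → ℝ) :
    Tendsto (fun n : ℕ => (∑ i ∈ Finset.range (N + 2), p i * sC i n) / sC 1 n / √(n:ℝ) ^ N) atTop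
      (𝓝 (p (N + 1) * kap N)) := by
  have hj : ∀ j ∈ Finset.range N, Tendsto (fun n : ℕ => p (j + 1) * (rR j n / √(n:ℝ) ^ (N - j))) atTop (𝓝 0) := by
    intro j hj
    have hj : j < N := Finset.mem_range.1 hj
    have := ((rR_tendsto j).1.div_atTop
      ((tendsto_pow_atTop (show N - j ≠ 0 by omega)).comp sqrt_nat_tendsto)).const_mul (p (j + 1))
    rw [mul_zero] at this
    exact this
  have h := (tendsto_finsetSum _ hj).add ((rR_tendsto N).1.const_mul (p (N + 1)))
  rw [Finset.sum_const_zero, zero_add] at h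
  refine h.congr' ?_
  filter_upwards [eventually_ge_atTop 1] with n hn
  have hr : 0 < √(n:ℝ) := Real.sqrt_pos.2 (by exact_mod_cast hn)
  rw [Finset.sum_range_succ', sC_zero n hn, mul_zero, add_zero, Finset.sum_range_succ, add_div, add_div]
  congr 1
  · rw [Finset.sum_div, Finset.sum_div]
    refine Finset.sum_congr rfl fun j hj => ?_
    have hj : j < N := Finset.mem_range.1 hj
    have e : √(n:ℝ) ^ N = √(n:ℝ) ^ j * √(n:ℝ) ^ (N - j) := by
      rw [← pow_add]; congr 1; omega
    rw [e, rR]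
    field_simp
  · rw [rR]; ring

/-- raw moments -/
noncomputable def rawM (k n : ℕ) : ℝ :=
  (∑ p ∈ RootedLabeledTrees n, (rlTotalHeight n p : ℝ) ^ k) / ((RootedLabeledTrees n).card : ℝ)

lemma card_RLT (n : ℕ) : ((RootedLabeledTrees n).card : ℝ) = n.factorial * PowerSeries.coeff 0 (fF n) := by
  have h := sum_rooted_pow n 0
  simpa using h

lemma card_RLT_pos (n : ℕ) (hn : 1 ≤ n) : 0 < ((RootedLabeledTrees n).card : ℝ) := by
  have h := coeff_fF_zero n
  rw [if_neg (by omega)] at h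
  rw [card_RLT]
  have hn' : (0:ℝ) < n := by exact_mod_cast hn
  have : PowerSeries.coeff 0 (fF n) = sC 1 n / n := by rw [eq_div_iff hn'.ne', ← h]; ring
  have h1 := sC_one_pos n hn
  rw [this]; positivity

lemma rawM_eq (k n : ℕ) (hn : 1 ≤ n) :
    rawM k n = k.factorial * (n * (PowerSeries.coeff k (fF n) / sC 1 n)) := by
  have h := coeff_fF_zero n
  rw [if_neg (by omega)] at h
  have hn' : (0:ℝ) < n := by exact_mod_cast hn
  have h1 := sC_one_pos n hn
  have hc : PowerSeries.coeff 0 (fF n) ≠ 0 := by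
    intro h0; rw [h0] at h; linarith
  rw [rawM, sum_rooted_pow, card_RLT, ← h]
  have : (n.factorial : ℝ) ≠ 0 := by positivity
  field_simp

lemma rawM_tendsto (k N : ℕ) (h0 : k ≠ 0) (hk : k ≤ 6) (hN : N + 2 = 3 * k) (hl : (pk k).length = N + 2) :
    Tendsto (fun n : ℕ => rawM k n / √(n:ℝ) ^ (3 * k)) atTop
      (𝓝 (k.factorial * ((((pk k).getD (N + 1) 0 : ℚ) : ℝ) * kap N))) := by
  have h := (poly_tendsto N (fun i => (((pk k).getD i 0 : ℚ) : ℝ))).const_mul (k.factorial : ℝ)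
  refine h.congr' ?_
  filter_upwards [eventually_ge_atTop 1] with n hn
  have hr : 0 < √(n:ℝ) := Real.sqrt_pos.2 (by exact_mod_cast hn)
  have hs : √(n:ℝ) ^ 2 = n := Real.sq_sqrt (by positivity)
  have h1 := sC_one_pos n hn
  rw [rawM_eq k n hn, coeff_fF_eq k n h0 hk, hl, ← hN, pow_add]
  generalize (∑ i ∈ Finset.range (N + 2), (((pk k).getD i 0 : ℚ) : ℝ) * sC i n) = S
  rw [hs]
  have hn' : (n:ℝ) ≠ 0 := by rw [← hs]; positivity
  field_simp

lemma c1 : Tendsto (fun n : ℕ => rawM 1 n / √(n:ℝ) ^ 3) atTop (𝓝 (√(Real.pi / 2))) := by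
  have h := rawM_tendsto 1 1 (by norm_num) (by norm_num) rfl rfl
  convert h using 2
  norm_num [pk, kap, Nat.factorial]

lemma c2 : Tendsto (fun n : ℕ => rawM 2 n / √(n:ℝ) ^ 6) atTop (𝓝 (5 / 3)) := by
  have h := rawM_tendsto 2 4 (by norm_num) (by norm_num) rfl rfl
  convert h using 2
  norm_num [pk, kap, Nat.factorial]

lemma c3 : Tendsto (fun n : ℕ => rawM 3 n / √(n:ℝ) ^ 9) atTop (𝓝 (15 / 8 * √(Real.pi / 2))) := by
  have h := rawM_tendsto 3 7 (by norm_num) (by norm_num) rfl rfl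
  convert h using 2
  norm_num [pk, kap, Nat.factorial]
  ring

lemma c4 : Tendsto (fun n : ℕ => rawM 4 n / √(n:ℝ) ^ 12) atTop (𝓝 (221 / 63)) := by
  have h := rawM_tendsto 4 10 (by norm_num) (by norm_num) rfl rfl
  convert h using 2
  norm_num [pk, kap, Nat.factorial]

lemma c5 : Tendsto (fun n : ℕ => rawM 5 n / √(n:ℝ) ^ 15) atTop (𝓝 (565 / 128 * √(Real.pi / 2))) := by
  have h := rawM_tendsto 5 13 (by norm_num) (by norm_num) rfl rfl
  convert h using 2
  norm_num [pk, kap, Nat.factorial]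
  ring

lemma c6 : Tendsto (fun n : ℕ => rawM 6 n / √(n:ℝ) ^ 18) atTop (𝓝 (82825 / 9009)) := by
  have h := rawM_tendsto 6 16 (by norm_num) (by norm_num) rfl rfl
  convert h using 2
  norm_num [pk, kap, Nat.factorial]

end E3sec


lemma rlMu_eq (n : ℕ) : rlMu n = rawM 1 n := by simp [rlMu, rawM]

lemma cm_expand (i n : ℕ) : rlCentralMoment i n =
    ∑ m ∈ Finset.range (i + 1), rawM m n * (-(rawM 1 n)) ^ (i - m) * (i.choose m : ℝ) := by
  unfold rlCentralMoment
  simp_rw [rlMu_eq, sub_eq_add_neg, add_pow]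
  rw [Finset.sum_comm, Finset.sum_div]
  refine Finset.sum_congr rfl fun m _ => ?_
  simp_rw [mul_assoc]
  rw [← Finset.sum_mul]
  nth_rewrite 2 [rawM]
  ring

lemma rawM_zero (n : ℕ) (hn : 1 ≤ n) : rawM 0 n = 1 := by
  have := (card_RLT_pos n hn).ne'
  simp only [rawM, pow_zero, Finset.sum_const, nsmul_eq_mul, mul_one]
  exact div_self this

open Filter Real

/-- The `6`-th scaled moment of the total height on rooted labeled trees on `n`
vertices converges, as `n → ∞`, to the stated constant. -/
theorem totalheight_stmt17 :
    Tendsto (fun n : ℕ => rlAlpha 6 n) atTop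
      (nhds ((15 / 16016) * (-144144 * π ^ 3 - 720720 * π ^ 2 + 3013725 * π + 2120320) / (10 - 3 * π) ^ 3)) := by
  have hpi : π < 3.15 := Real.pi_lt_d2
  have hq : √(π / 2) ^ 2 = π / 2 := Real.sq_sqrt (by positivity)
  have L2 := c2.sub (c1.pow 2)
  have L6 := (((((c6.sub ((c5.mul c1).const_mul 6)).add ((c4.mul (c1.pow 2)).const_mul 15)).sub
    ((c3.mul (c1.pow 3)).const_mul 20)).add ((c2.mul (c1.pow 4)).const_mul 15)).sub
    ((c1.pow 6).const_mul 5))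
  have hne : (5 / 3 - √(π / 2) ^ 2) ^ 3 ≠ 0 := by
    rw [hq]
    apply pow_ne_zero
    intro h; linarith
  have hlim := L6.div (L2.pow 3) hne
  have hval : (15 / 16016) * (-144144 * π ^ 3 - 720720 * π ^ 2 + 3013725 * π + 2120320) / (10 - 3 * π) ^ 3
      = (82825 / 9009 - 6 * (565 / 128 * √(π / 2) * √(π / 2)) + 15 * (221 / 63 * √(π / 2) ^ 2)
        - 20 * (15 / 8 * √(π / 2) * √(π / 2) ^ 3) + 15 * (5 / 3 * √(π / 2) ^ 4) - 5 * √(π / 2) ^ 6)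
        / (5 / 3 - √(π / 2) ^ 2) ^ 3 := by
    have hd : (10 - 3 * π) ^ 3 ≠ 0 := by
      apply pow_ne_zero
      intro h; linarith
    have e4 : √(π / 2) ^ 4 = (π / 2) ^ 2 := by
      linear_combination (√(π / 2) ^ 2 + π / 2) * hq
    have e6 : √(π / 2) ^ 6 = (π / 2) ^ 3 := by
      rw [show √(π / 2) ^ 6 = (√(π / 2) ^ 2) ^ 3 by ring, hq]
    have e1 : 565 / 128 * √(π / 2) * √(π / 2) = 565 / 128 * (π / 2) := by
      linear_combination 565 / 128 * hq
    have e3 : 15 / 8 * √(π / 2) * √(π / 2) ^ 3 = 15 / 8 * √(π / 2) ^ 4 := by ring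
    rw [e3, e1, e4, e6, hq]
    rw [hq] at hne
    rw [div_eq_div_iff hd hne]
    ring
  rw [hval]
  refine hlim.congr' ?_
  filter_upwards [eventually_ge_atTop 1] with n hn
  have hr : 0 < √(n:ℝ) := Real.sqrt_pos.2 (by exact_mod_cast hn)
  have h0 := rawM_zero n hn
  have m2 : rlCentralMoment 2 n = rawM 2 n - rawM 1 n ^ 2 := by
    rw [cm_expand]
    simp only [Finset.sum_range_succ, Finset.sum_range_zero, h0]
    norm_num [Nat.choose]
    ring
  have m6 : rlCentralMoment 6 n = rawM 6 n - 6 * (rawM 5 n * rawM 1 n) + 15 * (rawM 4 n * rawM 1 n ^ 2)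
      - 20 * (rawM 3 n * rawM 1 n ^ 3) + 15 * (rawM 2 n * rawM 1 n ^ 4) - 5 * rawM 1 n ^ 6 := by
    rw [cm_expand]
    simp only [Finset.sum_range_succ, Finset.sum_range_zero, h0]
    norm_num [Nat.choose]
    ring
  have hex : ((6 : ℕ) : ℝ) / 2 = ((3 : ℕ) : ℝ) := by norm_num
  rw [rlAlpha, hex, Real.rpow_natCast, m2, m6]
  simp only [Pi.div_apply]
  set s := √(n:ℝ)
  have a2 : rawM 2 n / s ^ 6 - (rawM 1 n / s ^ 3) ^ 2 = (rawM 2 n - rawM 1 n ^ 2) / s ^ 6 := by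
    field_simp
  rw [a2, div_pow (rawM 2 n - rawM 1 n ^ 2) (s ^ 6) 3, div_div_eq_mul_div]
  congr 1
  field_simp
end
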